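/- For every integer m ≥ 2, there exist infinitely many radimichael numbers with exactly m distinct prime factors (each squarefree) that are not Carmichael numbers. -/

import Mathlib

/-- The radical of a natural number: the product of its distinct prime factors,
i.e. its largest squarefree divisor. -/
def rad (n : ℕ) : ℕ := ∏ p ∈ n.primeFactors, p

/-- A composite natural number `n` is a Carmichael number if `a ^ n ≡ a (mod n)`
for every integer `a`. -/
def IsCarmichael (n : ℕ) : Prop :=
  1 < n ∧ ¬ n.Prime ∧ ∀ a : ℤ, a ^ n ≡ a [ZMOD (n : ℤ)]

section

open Complex

/-- The sum of the terms of the Dirichlet series of `χ` over the `q`-th period. -/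
noncomputable def periodSum {d : ℕ} (χ : DirichletCharacter ℂ d) (q : ℕ) (s : ℂ) : ℂ :=
  ∑ a : Fin d, χ ((a : ℕ) : ZMod d) * ((q * d + a : ℕ) : ℂ) ^ (-s)

lemma sum_fin_dirichletCharacter_eq_zero {d : ℕ} [NeZero d] {χ : DirichletCharacter ℂ d}
    (hχ : χ ≠ 1) : ∑ a : Fin d, χ ((a : ℕ) : ZMod d) = 0 := by
  obtain ⟨n, rfl⟩ := Nat.exists_eq_succ_of_ne_zero (NeZero.ne d)
  rw [← MulChar.sum_eq_zero_of_ne_one hχ]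
  refine Finset.sum_congr rfl fun a _ => ?_
  congr 1
  exact ZMod.natCast_zmod_val (n := n + 1) a

lemma LFunction_eq_tsum_periodSum {d : ℕ} [NeZero d] (χ : DirichletCharacter ℂ d) {s : ℂ}
    (hs : 1 < s.re) : χ.LFunction s = ∑' q, periodSum χ q s := by
  have hs0 : s ≠ 0 := fun h => by simp [h] at hs; linarith
  rw [χ.LFunction_eq_LSeries hs]
  have h := (DirichletCharacter.LSeriesSummable_of_one_lt_re χ hs).hasSum
  have h2 := ((Nat.divModEquiv d).symm.hasSum_iff).mpr h
  refine (h2.prod_fiberwise fun q => hasSum_fintype _).tsum_eq.symm.trans ?_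
  refine tsum_congr fun q => Finset.sum_congr rfl fun a _ => ?_
  have : (Nat.divModEquiv d).symm (q, a) = q * d + a := by simp [Nat.divModEquiv]
  simp only [Function.comp, this, LSeries.term]
  split_ifs with h0
  · simp [h0, hs0]
  · rw [cpow_neg, div_eq_mul_inv]
    simp

lemma norm_cpow_neg_sub_cpow_neg_le {x y : ℝ} (hx : 0 < x) (hxy : x ≤ y) {s : ℂ}
    (hs : 0 < s.re) :
    ‖(y : ℂ) ^ (-s) - (x : ℂ) ^ (-s)‖ ≤ ‖s‖ * x ^ (-s.re - 1) * (y - x) := by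
  have hs0 : -s ≠ 0 := fun h => by simp at h; simp [h] at hs
  have := Convex.norm_image_sub_le_of_norm_hasDerivWithin_le (𝕜 := ℝ) (s := Set.Icc x y)
    (f := fun t : ℝ => (t : ℂ) ^ (-s)) (f' := fun t : ℝ => -s * (t : ℂ) ^ (-s - 1))
    (C := ‖s‖ * x ^ (-s.re - 1)) (x := x) (y := y)
    (fun t ht => (hasDerivAt_ofReal_cpow_const (hx.trans_le ht.1).ne' hs0).hasDerivWithinAt)
    (fun t ht => by
      rw [norm_mul, norm_neg, norm_cpow_eq_rpow_re_of_pos (hx.trans_le ht.1)]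
      gcongr
      exact Real.rpow_le_rpow_of_nonpos hx ht.1 (by simp; linarith))
    (convex_Icc x y) ⟨le_rfl, hxy⟩ ⟨hxy, le_rfl⟩
  simpa [abs_of_nonneg (sub_nonneg.mpr hxy)] using this

lemma norm_periodSum_succ_le {d : ℕ} [NeZero d] {χ : DirichletCharacter ℂ d} (hχ : χ ≠ 1)
    (q : ℕ) {s : ℂ} (hs : 0 < s.re) :
    ‖periodSum χ (q + 1) s‖ ≤ ‖s‖ * (d : ℝ) ^ (1 - s.re) * ((q : ℝ) + 1) ^ (-s.re - 1) := by
  have hd : (0 : ℝ) < d := by exact_mod_cast Nat.pos_of_ne_zero (NeZero.ne d)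
  have key : periodSum χ (q + 1) s = ∑ a : Fin d, χ ((a : ℕ) : ZMod d) *
      ((((q + 1) * d + a : ℝ) : ℂ) ^ (-s) - (((q + 1) * d : ℝ) : ℂ) ^ (-s)) := by
    simp_rw [mul_sub, Finset.sum_sub_distrib, ← Finset.sum_mul,
      sum_fin_dirichletCharacter_eq_zero hχ, periodSum]
    simp
  rw [key]
  have hb : ∀ a : Fin d, ‖χ ((a : ℕ) : ZMod d) *
      ((((q + 1) * d + a : ℝ) : ℂ) ^ (-s) - (((q + 1) * d : ℝ) : ℂ) ^ (-s))‖ ≤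
      ‖s‖ * ((q + 1) * d : ℝ) ^ (-s.re - 1) * d := by
    intro a
    rw [norm_mul]
    refine (mul_le_of_le_one_left (norm_nonneg _) (χ.norm_le_one _)).trans ?_
    refine (norm_cpow_neg_sub_cpow_neg_le (by positivity) (by simp) hs).trans ?_
    gcongr
    have : (a : ℝ) ≤ d := by exact_mod_cast a.2.le
    linarith
  refine (norm_sum_le _ _).trans ((Finset.sum_le_sum fun a _ => hb a).trans ?_)
  rw [Finset.sum_const, Finset.card_univ, Fintype.card_fin, nsmul_eq_mul,
    Real.mul_rpow (by positivity) hd.le]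
  have : (d : ℝ) ^ (1 - s.re) = (d : ℝ) ^ (-s.re - 1) * d * d := by
    rw [mul_assoc, ← pow_two, ← Real.rpow_natCast, ← Real.rpow_add hd]
    congr 1; push_cast; ring
  rw [this]
  apply le_of_eq; ring

lemma summable_add_one_rpow {a : ℝ} (ha : a < -1) : Summable fun q : ℕ => ((q : ℝ) + 1) ^ a := by
  have := (summable_nat_add_iff 1).mpr (Real.summable_nat_rpow.mpr ha)
  simpa using this

lemma LFunction_eq_periodSum_add_tsum {d : ℕ} [NeZero d] {χ : DirichletCharacter ℂ d}
    (hχ : χ ≠ 1) {s : ℂ} (hs : 1 / 2 ≤ s.re) (hs2 : ‖s‖ < 2) :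
    χ.LFunction s = periodSum χ 0 s + ∑' q, periodSum χ (q + 1) s := by
  have hd : (1 : ℝ) ≤ d := by exact_mod_cast Nat.pos_of_ne_zero (NeZero.ne d)
  have hd' : d ≠ 1 := by
    rintro rfl
    exact hχ (Subsingleton.elim _ _)
  set U : Set ℂ := {s | 1 / 4 < s.re} ∩ Metric.ball 0 2 with hU
  have hUo : IsOpen U := (isOpen_lt continuous_const continuous_re).inter Metric.isOpen_ball
  have hUc : IsPreconnected U :=
    ((convex_halfSpace_re_gt (1 / 4)).inter (convex_ball _ _)).isPreconnected
  have hdiff : ∀ q, Differentiable ℂ (periodSum χ q) := by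
    intro q
    unfold periodSum
    refine Differentiable.fun_sum fun a _ => ?_
    by_cases h0 : q * d + (a : ℕ) = 0
    · have : (a : ℕ) = 0 := by omega
      have : χ ((a : ℕ) : ZMod d) = 0 := by
        rw [this]; push_cast
        have : Fact (1 < d) := ⟨by have := NeZero.ne d; omega⟩
        exact χ.map_nonunit not_isUnit_zero
      simp only [this, zero_mul]
      exact differentiable_const _
    · have hne : ((q * d + a : ℕ) : ℂ) ≠ 0 := by exact_mod_cast h0
      exact (differentiable_const _).mul
        (differentiable_id.neg.const_cpow (Or.inl hne))
  have hbound : ∀ q, ∀ w ∈ U, ‖periodSum χ (q + 1) w‖ ≤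
      2 * (d : ℝ) ^ (3 / 4 : ℝ) * ((q : ℝ) + 1) ^ (-(5 / 4) : ℝ) := by
    intro q w hw
    have h1 : 1 / 4 < w.re := hw.1
    have h2 : ‖w‖ < 2 := by simpa using hw.2
    refine (norm_periodSum_succ_le hχ q (by linarith)).trans ?_
    gcongr
    · linarith
    · linarith [(Nat.cast_nonneg q : (0 : ℝ) ≤ q)]
    · linarith
  have hsum : Summable fun q : ℕ =>
      2 * (d : ℝ) ^ (3 / 4 : ℝ) * ((q : ℝ) + 1) ^ (-(5 / 4) : ℝ) :=
    (summable_add_one_rpow (by norm_num)).mul_left _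
  have hG : DifferentiableOn ℂ (fun w => periodSum χ 0 w + ∑' q, periodSum χ (q + 1) w) U :=
    (hdiff 0).differentiableOn.add (differentiableOn_tsum_of_summable_norm hsum
      (fun q => (hdiff _).differentiableOn) hUo hbound)
  have hz : (3 / 2 : ℂ) ∈ U := by
    constructor
    · simp; norm_num
    · simp; norm_num
  have hev : χ.LFunction =ᶠ[nhds (3 / 2 : ℂ)]
      fun w => periodSum χ 0 w + ∑' q, periodSum χ (q + 1) w := by
    have ho : IsOpen (U ∩ {s : ℂ | 1 < s.re}) :=
      hUo.inter (isOpen_lt continuous_const continuous_re)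
    filter_upwards [ho.mem_nhds ⟨hz, by simp; norm_num⟩] with w hw
    rw [LFunction_eq_tsum_periodSum χ hw.2]
    have : Summable fun q => periodSum χ (q + 1) w :=
      Summable.of_norm_bounded hsum fun q => hbound q w hw.1
    exact ((summable_nat_add_iff (f := fun q => periodSum χ q w) 1).mp this).tsum_eq_zero_add
  exact AnalyticOnNhd.eqOn_of_preconnected_of_eventuallyEq
    ((DirichletCharacter.differentiable_LFunction hχ).differentiableOn.analyticOnNhd hUo)
    (hG.analyticOnNhd hUo) hUc hz hev ⟨by simp; linarith, by simpa using hs2⟩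

lemma exists_norm_LFunction_le : ∃ A : ℝ, 1 ≤ A ∧ ∀ (d : ℕ) [NeZero d]
    (χ : DirichletCharacter ℂ d), χ ≠ 1 → ∀ l : ℝ, 2 ≤ l → Real.log d ≤ l → ∀ s : ℂ,
    ‖s - 1‖ ≤ 1 / l → ‖χ.LFunction s‖ ≤ A * l := by
  set Z : ℝ := ∑' q : ℕ, ((q : ℝ) + 1) ^ (-(3 / 2) : ℝ) with hZ
  have hZ0 : 0 ≤ Z := tsum_nonneg fun q => by positivity
  have hsumZ : Summable fun q : ℕ => ((q : ℝ) + 1) ^ (-(3 / 2) : ℝ) :=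
    summable_add_one_rpow (by norm_num)
  refine ⟨6 + 6 * Z, by linarith, fun d _ χ hχ l hl hdl s hs => ?_⟩
  have hd1 : (1 : ℝ) ≤ d := by exact_mod_cast Nat.pos_of_ne_zero (NeZero.ne d)
  have hl2 : 1 / l ≤ 1 / 2 := by gcongr
  have hre : |s.re - 1| ≤ 1 / l := by
    have := abs_re_le_norm (s - 1)
    simp only [sub_re, one_re] at this
    exact this.trans hs
  obtain ⟨hre1, hre2⟩ := abs_le.mp hre
  have hs2 : ‖s‖ ≤ 3 / 2 := by
    have := norm_add_le (s - 1) 1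
    simp only [sub_add_cancel, norm_one] at this
    linarith
  have hde : ∀ n : ℝ, 1 ≤ n → n ≤ d → n ^ (1 - s.re) ≤ 3 := by
    intro n hn hnd
    rw [Real.rpow_def_of_pos (by linarith)]
    have h1 : Real.log n * (1 - s.re) ≤ 1 := by
      have hlog : 0 ≤ Real.log n := Real.log_nonneg hn
      have hlog2 : Real.log n ≤ l := (Real.log_le_log (by linarith) hnd).trans hdl
      calc Real.log n * (1 - s.re) ≤ Real.log n * (1 / l) := by gcongr; linarith
        _ ≤ l * (1 / l) := by gcongr
        _ = 1 := by field_simp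
    exact (Real.exp_le_exp.mpr h1).trans (Real.exp_one_lt_d9.le.trans (by norm_num))
  rw [LFunction_eq_periodSum_add_tsum hχ (by linarith) (by linarith)]
  have h0 : ‖periodSum χ 0 s‖ ≤ 3 * (1 + l) := by
    have hd' : d ≠ 1 := by
      rintro rfl
      exact hχ (Subsingleton.elim _ _)
    have hFact : Fact (1 < d) := ⟨by have := NeZero.ne d; omega⟩
    have e1 : periodSum χ 0 s =
        ∑ n ∈ Finset.range d, χ (n : ZMod d) * ((n : ℕ) : ℂ) ^ (-s) := by
      rw [Finset.sum_range]; simp [periodSum]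
    obtain ⟨m, hm⟩ := Nat.exists_eq_succ_of_ne_zero (NeZero.ne d)
    have e2 : ‖periodSum χ 0 s‖ ≤ ∑ i ∈ Finset.range m, 3 * ((i + 1 : ℝ))⁻¹ := by
      have hr : Finset.range d = Finset.range (m + 1) := by rw [hm]
      rw [e1, hr, Finset.sum_range_succ']
      have : χ ((0 : ℕ) : ZMod d) = 0 := by
        push_cast
        exact χ.map_nonunit not_isUnit_zero
      rw [this, zero_mul, add_zero]
      refine (norm_sum_le _ _).trans (Finset.sum_le_sum fun i hi => ?_)
      rw [norm_mul, norm_natCast_cpow_of_pos (Nat.succ_pos i)]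
      refine (mul_le_of_le_one_left (by positivity) (χ.norm_le_one _)).trans ?_
      have hi' : ((i + 1 : ℕ) : ℝ) ≤ d := by
        exact_mod_cast (by have := Finset.mem_range.mp hi; omega)
      have hp : (0 : ℝ) < ((i + 1 : ℕ) : ℝ) := by positivity
      have : ((i + 1 : ℕ) : ℝ) ^ (-s).re =
          ((i + 1 : ℕ) : ℝ) ^ (1 - s.re) * ((i + 1 : ℕ) : ℝ)⁻¹ := by
        rw [← Real.rpow_neg_one, ← Real.rpow_add hp]
        congr 1; simp only [neg_re]; ring
      rw [this]
      have h3 := hde ((i + 1 : ℕ) : ℝ) (by push_cast; linarith [(Nat.cast_nonneg i : (0 : ℝ) ≤ i)])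
        hi'
      calc _ ≤ 3 * ((i + 1 : ℕ) : ℝ)⁻¹ := by gcongr
        _ = _ := by push_cast; rfl
    refine e2.trans ?_
    rw [← Finset.mul_sum]
    have hh : ∑ i ∈ Finset.range m, ((i + 1 : ℝ))⁻¹ = ((harmonic m : ℚ) : ℝ) := by
      simp [harmonic]
    rw [hh]
    have hlm : Real.log m ≤ l := by
      rcases Nat.eq_zero_or_pos m with h | h
      · simp [h]; linarith
      · exact (Real.log_le_log (by exact_mod_cast h)
          (by exact_mod_cast (by omega : m ≤ d))).trans hdl
    linarith [harmonic_le_one_add_log m]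
  have h1 : ‖∑' q, periodSum χ (q + 1) s‖ ≤ 3 / 2 * 3 * Z := by
    refine tsum_of_norm_bounded ((hsumZ.hasSum).mul_left (3 / 2 * 3)) fun q => ?_
    refine (norm_periodSum_succ_le hχ q (by linarith)).trans ?_
    gcongr
    · exact hde d hd1 le_rfl
    · linarith [(Nat.cast_nonneg q : (0 : ℝ) ≤ q)]
    · linarith
  refine (norm_add_le _ _).trans ?_
  nlinarith

lemma tsum_one_div_rpow_le {y : ℝ} (hy : 0 < y) :
    ∑' n : ℕ, 1 / ((n : ℝ) + 1) ^ (1 + y) ≤ 1 + 1 / y := by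
  have h := ZetaAsymptotics.zeta_limit_aux1 (s := 1 + y) (by linarith)
  have h2 : 0 ≤ ZetaAsymptotics.termTSum (1 + y) :=
    tsum_nonneg fun n => ZetaAsymptotics.term_nonneg _ _
  have e : (1 + y) - 1 = y := by ring
  rw [e] at h
  have : 0 ≤ (1 + y) * ZetaAsymptotics.termTSum (1 + y) := by positivity
  linarith

lemma summable_one_div_add_one_rpow {y : ℝ} (hy : 0 < y) :
    Summable fun n : ℕ => 1 / ((n : ℝ) + 1) ^ (1 + y) := by
  have := (summable_nat_add_iff 1).mpr (Real.summable_one_div_nat_rpow.mpr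
    (by linarith : 1 < 1 + y))
  simpa using this

lemma norm_LFunctionTrivChar_le (d : ℕ) [NeZero d] {x : ℝ} (hx : 0 < x) :
    ‖DirichletCharacter.LFunctionTrivChar d (1 + x)‖ ≤ 1 + 1 / x := by
  have hre : 1 < (1 + x : ℂ).re := by simp [hx]
  rw [DirichletCharacter.LFunctionTrivChar, DirichletCharacter.LFunction_eq_LSeries _ hre, LSeries,
    (DirichletCharacter.LSeriesSummable_of_one_lt_re _ hre).tsum_eq_zero_add]
  simp only [LSeries.term_zero, zero_add]
  refine le_trans ?_ (tsum_one_div_rpow_le hx)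
  refine tsum_of_norm_bounded (summable_one_div_add_one_rpow hx).hasSum fun n => ?_
  rw [LSeries.norm_term_eq]
  simp only [if_false, add_eq_zero, one_ne_zero, and_false]
  push_cast
  have : (1 + x : ℂ).re = 1 + x := by simp
  rw [this]
  gcongr
  exact DirichletCharacter.norm_le_one _ _

lemma factorsThrough_of_sq_eq_one {d e : ℕ} [NeZero d] [NeZero (d * e)] (he : Odd e)
    (hp : e.primeFactors ⊆ d.primeFactors) {χ : DirichletCharacter ℂ (d * e)} (hχ : χ ^ 2 = 1) :
    χ.FactorsThrough d := by
  have he0 : e ≠ 0 := fun h => NeZero.ne (d * e) (by simp [h])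
  rw [DirichletCharacter.factorsThrough_iff_ker_unitsMap (Dvd.intro e rfl)]
  intro v hv
  have hcard : Nat.card (ZMod.unitsMap (Dvd.intro e rfl : d ∣ d * e)).ker = e := by
    have h1 := Subgroup.card_mul_index (ZMod.unitsMap (Dvd.intro e rfl : d ∣ d * e)).ker
    rw [Subgroup.index_ker, MonoidHom.range_eq_top.mpr (ZMod.unitsMap_surjective _)] at h1
    simp only [Subgroup.card_top, Nat.card_eq_fintype_card, ZMod.card_units_eq_totient] at h1
    have h2 : (d * e).totient = e * d.totient := by
      rw [mul_comm d e]
      have : ∀ p, p.Prime → p ∣ e → p ∣ d := fun p hpp hpe =>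
        Nat.dvd_of_mem_primeFactors (hp (Nat.mem_primeFactors.mpr ⟨hpp, hpe, he0⟩))
      have hrad : (e * d).primeFactors = d.primeFactors := by
        rw [Nat.primeFactors_mul he0 (NeZero.ne d)]
        exact Finset.union_eq_right.mpr hp
      have ha := Nat.totient_mul_prod_primeFactors (e * d)
      have hb := Nat.totient_mul_prod_primeFactors d
      rw [hrad] at ha
      have hpos : 0 < ∏ p ∈ d.primeFactors, p :=
        Finset.prod_pos fun p hp => (Nat.prime_of_mem_primeFactors hp).pos
      apply Nat.eq_of_mul_eq_mul_right hpos
      rw [ha, mul_assoc e, mul_assoc e, hb]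
    rw [h2] at h1
    exact Nat.eq_of_mul_eq_mul_right (Nat.totient_pos.mpr (Nat.pos_of_ne_zero (NeZero.ne d)))
      (by rw [Nat.card_eq_fintype_card]; exact h1)
  have hve : v ^ e = 1 := by
    have := pow_card_eq_one' (x := (⟨v, hv⟩ : (ZMod.unitsMap (Dvd.intro e rfl : d ∣ d * e)).ker))
    rw [hcard] at this
    exact congrArg Subtype.val this
  rw [MonoidHom.mem_ker]
  have h1 : (MulChar.toUnitHom χ v) ^ e = 1 := by rw [← map_pow, hve, map_one]
  have h2 : (MulChar.toUnitHom χ v) ^ 2 = 1 := by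
    ext
    have := congrArg (fun ψ : DirichletCharacter ℂ (d * e) => ψ (v : ZMod (d * e))) hχ
    simp only [MulChar.pow_apply_coe, MulChar.one_apply_coe] at this
    simpa using this
  obtain ⟨k, rfl⟩ := he
  rwa [pow_succ, pow_mul, h2, one_pow, one_mul] at h1

lemma LFunction_changeLevel_of_primeFactors_eq {d D : ℕ} [NeZero d] [NeZero D] (h : d ∣ D)
    (hp : D.primeFactors = d.primeFactors) {χ : DirichletCharacter ℂ d} (hχ : χ ≠ 1) :
    (DirichletCharacter.changeLevel h χ).LFunction = χ.LFunction := by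
  ext s
  rw [DirichletCharacter.LFunction_changeLevel h χ (Or.inl hχ)]
  convert mul_one _
  refine Finset.prod_eq_one fun p hpm => ?_
  rw [hp] at hpm
  have : χ (p : ZMod d) = 0 := by
    refine χ.map_nonunit fun hu => ?_
    rw [ZMod.isUnit_iff_coprime] at hu
    exact (Nat.prime_of_mem_primeFactors hpm).one_lt.ne'
      (Nat.eq_one_of_dvd_coprimes hu dvd_rfl (Nat.dvd_of_mem_primeFactors hpm))
  simp [this]

lemma LFunctionTrivChar₁_of_primeFactors_eq {d D : ℕ} [NeZero d] [NeZero D]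
    (hp : D.primeFactors = d.primeFactors) :
    DirichletCharacter.LFunctionTrivChar₁ D = DirichletCharacter.LFunctionTrivChar₁ d := by
  ext s
  rcases eq_or_ne s 1 with rfl | hs
  · simp [DirichletCharacter.LFunctionTrivChar₁, hp]
  · simp [DirichletCharacter.LFunctionTrivChar₁, hs,
      DirichletCharacter.LFunctionTrivChar_eq_mul_riemannZeta hs, hp]

lemma exists_norm_logDeriv_le_near_one (d : ℕ) [NeZero d] : ∃ r > 0, ∃ M : ℝ, ∀ s : ℂ, ‖s - 1‖ < r →
    (DirichletCharacter.LFunctionTrivChar₁ d s ≠ 0 ∧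
      ‖logDeriv (DirichletCharacter.LFunctionTrivChar₁ d) s‖ ≤ M) ∧
    ∀ χ : DirichletCharacter ℂ d, χ ≠ 1 →
      χ.LFunction s ≠ 0 ∧ ‖logDeriv χ.LFunction s‖ ≤ M := by
  have key : ∀ f : ℂ → ℂ, Differentiable ℂ f → f 1 ≠ 0 →
      ∃ M : ℝ, ∀ᶠ s in nhds (1 : ℂ), f s ≠ 0 ∧ ‖logDeriv f s‖ ≤ M := by
    intro f hf h1
    refine ⟨‖logDeriv f 1‖ + 1, ?_⟩
    have hc : ContinuousAt (logDeriv f) 1 :=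
      (hf.contDiff (n := 1)).continuous_deriv_one.continuousAt.div hf.continuous.continuousAt h1
    filter_upwards [hf.continuous.continuousAt.eventually_ne h1,
      hc.norm.eventually_le_const (u := ‖logDeriv f 1‖ + 1) (by linarith)] with s a b
    exact ⟨a, b⟩
  obtain ⟨M0, hM0⟩ := key _ (DirichletCharacter.differentiable_LFunctionTrivChar₁ d)
    (DirichletCharacter.LFunctionTrivChar₁_apply_one_ne_zero d)
  have h2 : ∀ χ : DirichletCharacter ℂ d, ∃ M : ℝ, ∀ᶠ s in nhds (1 : ℂ), χ ≠ 1 →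
      χ.LFunction s ≠ 0 ∧ ‖logDeriv χ.LFunction s‖ ≤ M := by
    intro χ
    by_cases hχ : χ = 1
    · exact ⟨0, Filter.Eventually.of_forall fun s h => absurd hχ h⟩
    · obtain ⟨M, hM⟩ := key _ (DirichletCharacter.differentiable_LFunction hχ)
        (DirichletCharacter.LFunction_apply_one_ne_zero hχ)
      exact ⟨M, hM.mono fun s h _ => h⟩
  choose M hM using h2
  have hall := hM0.and (Filter.eventually_all.mpr hM)
  obtain ⟨r, hr, hball⟩ := Metric.eventually_nhds_iff.mp hall
  refine ⟨r, hr, |M0| + ∑ χ, |M χ|, fun s hs => ?_⟩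
  obtain ⟨⟨a, b⟩, c⟩ := hball (by rwa [dist_eq_norm])
  have hpos : 0 ≤ ∑ χ, |M χ| := Finset.sum_nonneg fun _ _ => abs_nonneg _
  refine ⟨⟨a, by linarith [le_abs_self M0]⟩, fun χ hχ => ⟨(c χ hχ).1, ?_⟩⟩
  have := Finset.single_le_sum (f := fun χ => |M χ|) (fun _ _ => abs_nonneg _)
    (Finset.mem_univ χ)
  linarith [(c χ hχ).2, le_abs_self (M χ), abs_nonneg M0]

lemma norm_deriv_LFunction_le {A : ℝ} {d : ℕ} [NeZero d] {χ : DirichletCharacter ℂ d}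
    (hχ : χ ≠ 1) {l : ℝ} (hl : 2 ≤ l)
    (hL : ∀ s : ℂ, ‖s - 1‖ ≤ 1 / l → ‖χ.LFunction s‖ ≤ A * l) {s : ℂ}
    (hs : ‖s - 1‖ ≤ 1 / (2 * l)) : ‖deriv χ.LFunction s‖ ≤ 2 * A * l ^ 2 := by
  have h := norm_deriv_le_of_forall_mem_sphere_norm_le (c := s) (R := 1 / (2 * l)) (C := A * l)
    (f := χ.LFunction) (by positivity)
    (DirichletCharacter.differentiable_LFunction hχ).diffContOnCl fun z hz => by
      refine hL z ?_
      have h1 : ‖z - s‖ = 1 / (2 * l) := by simpa [dist_eq_norm] using hz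
      calc ‖z - 1‖ = ‖(z - s) + (s - 1)‖ := by congr 1; ring
        _ ≤ ‖z - s‖ + ‖s - 1‖ := norm_add_le _ _
        _ ≤ 1 / (2 * l) + 1 / (2 * l) := by rw [h1]; gcongr
        _ = 1 / l := by field_simp; norm_num
  refine h.trans (le_of_eq ?_)
  field_simp

lemma le_norm_LFunction_of_sq_ne_one {A : ℝ} (hA : 1 ≤ A) {d : ℕ} [NeZero d]
    {χ : DirichletCharacter ℂ d} {l x : ℝ} (hl : 2 ≤ l)
    (hL : ∀ s : ℂ, ‖s - 1‖ ≤ 1 / l → ‖(χ ^ 2).LFunction s‖ ≤ A * l) {u : ℝ} (hu : 0 < u)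
    (hu1 : u ≤ 1) (hx : x = u ^ 4 / l ^ 9) :
    u ^ 3 / (2 * A * l ^ 7) ≤ ‖χ.LFunction (1 + x)‖ := by
  have hx0 : 0 < x := by rw [hx]; positivity
  have hxl : x ≤ 1 / l := by
    rw [hx, div_le_div_iff₀ (by positivity) (by positivity)]
    have h1 : u ^ 4 ≤ 1 := pow_le_one₀ hu.le hu1
    have h2 : l ≤ l ^ 9 := le_self_pow₀ (by linarith) (by norm_num)
    nlinarith
  have hl1 : 1 / l ≤ 1 := by rw [div_le_one (by linarith)]; linarith
  have h := DirichletCharacter.norm_LFunction_product_ge_one χ hx0 0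
  simp only [ofReal_zero, mul_zero, add_zero, norm_mul, norm_pow] at h
  have h2 : ‖(χ ^ 2).LFunction (1 + x)‖ ≤ A * l := hL _ (by simp [abs_of_pos hx0]; simpa using hxl)
  have h3 : ‖DirichletCharacter.LFunctionTrivChar d (1 + x)‖ ≤ 2 / x := by
    refine (norm_LFunctionTrivChar_le d hx0).trans ?_
    have : 1 ≤ 1 / x := by rw [le_div_iff₀ hx0]; linarith
    calc 1 + 1 / x ≤ 1 / x + 1 / x := by gcongr
      _ = 2 / x := by ring
  set Y := ‖χ.LFunction (1 + x)‖ with hY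
  have hY0 : 0 ≤ Y := norm_nonneg _
  have h4 : 1 ≤ (2 / x) ^ 3 * Y ^ 4 * (A * l) := by
    refine h.le.trans ?_
    gcongr
  have h5 : x ^ 3 ≤ 8 * A * l * Y ^ 4 := by
    have : (2 / x) ^ 3 * Y ^ 4 * (A * l) = 8 * A * l * Y ^ 4 / x ^ 3 := by
      field_simp; ring
    rw [this, one_le_div (by positivity)] at h4
    exact h4
  refine le_of_pow_le_pow_left₀ (n := 4) (by norm_num) hY0 ?_
  have h6 : (u ^ 3 / (2 * A * l ^ 7)) ^ 4 = x ^ 3 / (16 * A ^ 4 * l) := by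
    rw [hx]; field_simp; norm_num
  rw [h6, div_le_iff₀ (by positivity)]
  have hA4 : A ≤ A ^ 4 := le_self_pow₀ hA (by norm_num)
  have : 0 ≤ l * Y ^ 4 := by positivity
  nlinarith

lemma norm_logDeriv_le_of_sq_ne_one {A : ℝ} (hA : 1 ≤ A) {d : ℕ} [NeZero d]
    {χ : DirichletCharacter ℂ d} {l x : ℝ} (hl : 2 ≤ l)
    (hL : ∀ ψ : DirichletCharacter ℂ d, ψ ≠ 1 → ∀ s : ℂ, ‖s - 1‖ ≤ 1 / l →
      ‖ψ.LFunction s‖ ≤ A * l) (hχ : χ ^ 2 ≠ 1)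
    (hx : x = (1 / (16 * A ^ 2)) ^ 4 / l ^ 9) {s : ℂ} (hs : ‖s - (1 + x)‖ ≤ 2 * x) :
    χ.LFunction s ≠ 0 ∧ ‖logDeriv χ.LFunction s‖ ≤ 1 / x := by
  set u : ℝ := 1 / (16 * A ^ 2) with hu
  have hu0 : 0 < u := by positivity
  have hA2 : 1 ≤ A ^ 2 := one_le_pow₀ hA
  have hu16 : u ≤ 1 / 16 := by
    rw [hu]; gcongr; linarith
  have huA : 16 * A ^ 2 * u = 1 := by rw [hu]; field_simp
  have hχ1 : χ ≠ 1 := by rintro rfl; exact hχ (one_pow 2)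
  have hl0 : 0 < l := by linarith
  have hx0 : 0 < x := by rw [hx]; positivity
  have hlow := le_norm_LFunction_of_sq_ne_one hA hl (hL _ hχ) hu0 (by linarith) hx
  have hxl : 3 * x ≤ 1 / (2 * l) := by
    rw [hx, ← mul_div_assoc, div_le_div_iff₀ (by positivity) (by positivity)]
    have h1 : u ^ 4 ≤ (1 / 16) ^ 4 := by gcongr
    have h2 : l ≤ l ^ 9 := le_self_pow₀ (by linarith) (by norm_num)
    have h3 : u ^ 4 * l ≤ (1 / 16) ^ 4 * l := by gcongr
    linarith
  have hdisc : ∀ z ∈ Metric.closedBall (1 + x : ℂ) (2 * x), ‖deriv χ.LFunction z‖ ≤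
      2 * A * l ^ 2 := by
    intro z hz
    refine norm_deriv_LFunction_le hχ1 hl (hL χ hχ1) ?_
    have h1 : ‖z - (1 + x)‖ ≤ 2 * x := by simpa [dist_eq_norm] using hz
    calc ‖z - 1‖ = ‖(z - (1 + x)) + x‖ := by congr 1; ring
      _ ≤ ‖z - (1 + x)‖ + ‖(x : ℂ)‖ := norm_add_le _ _
      _ ≤ 2 * x + x := by simp [abs_of_pos hx0]; simpa using h1
      _ ≤ _ := by linarith
  have hsmem : s ∈ Metric.closedBall (1 + x : ℂ) (2 * x) := by simpa [dist_eq_norm] using hs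
  have hdiff := Convex.norm_image_sub_le_of_norm_deriv_le (𝕜 := ℂ) (f := χ.LFunction)
    (fun z _ => (DirichletCharacter.differentiable_LFunction hχ1) z) hdisc
    (convex_closedBall _ _) (Metric.mem_closedBall_self (by positivity)) hsmem
  have hdrop : ‖χ.LFunction s - χ.LFunction (1 + x)‖ ≤ u ^ 3 / (4 * A * l ^ 7) := by
    refine hdiff.trans ?_
    calc 2 * A * l ^ 2 * ‖s - (1 + x)‖ ≤ 2 * A * l ^ 2 * (2 * x) := by gcongr
      _ = (16 * A ^ 2 * u) * (u ^ 3 / (4 * A * l ^ 7)) := by rw [hx]; field_simp; norm_num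
      _ = _ := by rw [huA, one_mul]
  have hLs : u ^ 3 / (4 * A * l ^ 7) ≤ ‖χ.LFunction s‖ := by
    have h1 := norm_sub_norm_le (χ.LFunction (1 + x)) (χ.LFunction s)
    rw [norm_sub_rev] at h1
    have h2 : u ^ 3 / (2 * A * l ^ 7) = 2 * (u ^ 3 / (4 * A * l ^ 7)) := by field_simp; norm_num
    linarith
  have hpos : 0 < u ^ 3 / (4 * A * l ^ 7) := by positivity
  refine ⟨norm_pos_iff.mp (hpos.trans_le hLs), ?_⟩
  rw [logDeriv_apply, norm_div]
  calc _ ≤ 2 * A * l ^ 2 / (u ^ 3 / (4 * A * l ^ 7)) := by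
        gcongr
        exact hdisc s hsmem
    _ = (16 * A ^ 2 * u) / 2 * (1 / x) := by rw [hx]; field_simp; norm_num
    _ ≤ 1 / x := by rw [huA]; have : 0 ≤ 1 / x := by positivity
                    linarith

lemma exists_norm_logDeriv_le : ∃ c : ℝ, 0 < c ∧ c ≤ 1 / 16 ∧ ∀ (d : ℕ) [NeZero d],
    ∃ l₀ : ℝ, 2 ≤ l₀ ∧ ∀ l : ℝ, l₀ ≤ l → ∀ (e : ℕ) [NeZero (d * e)], Odd e →
    e.primeFactors ⊆ d.primeFactors → Real.log (d * e : ℕ) ≤ l → ∀ s : ℂ,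
    ‖s - (1 + (c / l ^ 9 : ℝ))‖ ≤ 2 * (c / l ^ 9) →
    (DirichletCharacter.LFunctionTrivChar₁ (d * e) s ≠ 0 ∧
      ‖logDeriv (DirichletCharacter.LFunctionTrivChar₁ (d * e)) s‖ ≤ 1 / (c / l ^ 9)) ∧
    ∀ χ : DirichletCharacter ℂ (d * e), χ ≠ 1 →
      χ.LFunction s ≠ 0 ∧ ‖logDeriv χ.LFunction s‖ ≤ 1 / (c / l ^ 9) := by
  obtain ⟨A, hA, hL⟩ := exists_norm_LFunction_le
  have hA2 : 1 ≤ A ^ 2 := one_le_pow₀ hA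
  set c : ℝ := (1 / (16 * A ^ 2)) ^ 4 with hc
  have hc0 : 0 < c := by positivity
  have hc1 : c ≤ 1 / 16 := by
    have : 1 / (16 * A ^ 2) ≤ 1 / 16 := by gcongr; linarith
    calc c ≤ (1 / 16) ^ 4 := by rw [hc]; gcongr
      _ ≤ _ := by norm_num
  refine ⟨c, hc0, hc1, fun d _ => ?_⟩
  obtain ⟨r, hr, M, hM⟩ := exists_norm_logDeriv_le_near_one d
  refine ⟨max 2 (max (1 / r) M), le_max_left _ _, fun l hl e _ he hp hdl s hs => ?_⟩
  have hl2 : 2 ≤ l := (le_max_left _ _).trans hl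
  have hlr : 1 / r ≤ l := ((le_max_left _ _).trans (le_max_right _ _)).trans hl
  have hlM : M ≤ l := ((le_max_right _ _).trans (le_max_right _ _)).trans hl
  have hl0 : 0 < l := by linarith
  have hll : l ≤ l ^ 9 := le_self_pow₀ (by linarith) (by norm_num)
  set x : ℝ := c / l ^ 9 with hx
  have hx0 : 0 < x := by positivity
  have hxl : x ≤ 1 / 16 / l := by rw [hx]; gcongr
  have hMx : M ≤ 1 / x := by
    rw [le_div_iff₀ hx0]
    have : l * x ≤ 1 / 16 := by
      calc l * x ≤ l * (1 / 16 / l) := by gcongr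
        _ = 1 / 16 := by field_simp
    nlinarith
  have hsr : ‖s - 1‖ < r := by
    have h1 : 1 / l ≤ r := by
      rw [div_le_iff₀ hl0]; rw [div_le_iff₀ hr] at hlr; linarith
    have h2 : 0 < 1 / l := by positivity
    calc ‖s - 1‖ = ‖(s - (1 + x)) + x‖ := by congr 1; ring
      _ ≤ ‖s - (1 + x)‖ + ‖(x : ℂ)‖ := norm_add_le _ _
      _ ≤ 2 * x + x := by
        have : ‖(x : ℂ)‖ = x := by simp [abs_of_pos hx0]
        rw [this]; gcongr
      _ ≤ 3 * (1 / 16 / l) := by linarith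
      _ = 3 / 16 * (1 / l) := by ring
      _ < r := by linarith
  have hpf : (d * e).primeFactors = d.primeFactors := by
    have he0 : e ≠ 0 := fun h => NeZero.ne (d * e) (by simp [h])
    rw [Nat.primeFactors_mul (NeZero.ne d) he0]
    exact Finset.union_eq_left.mpr hp
  obtain ⟨ht, hχs⟩ := hM s hsr
  rw [LFunctionTrivChar₁_of_primeFactors_eq hpf]
  refine ⟨⟨ht.1, ht.2.trans hMx⟩, fun χ hχ => ?_⟩
  by_cases h2 : χ ^ 2 = 1
  · obtain ⟨hdvd, χ₀, rfl⟩ := factorsThrough_of_sq_eq_one he hp h2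
    have hχ₀ : χ₀ ≠ 1 := by
      rintro rfl
      exact hχ (map_one _)
    rw [LFunction_changeLevel_of_primeFactors_eq hdvd hpf hχ₀]
    exact ⟨(hχs χ₀ hχ₀).1, (hχs χ₀ hχ₀).2.trans hMx⟩
  · exact norm_logDeriv_le_of_sq_ne_one hA hl2 (fun ψ hψ => hL _ ψ hψ l hl2 hdl) h2 hx hs

end

lemma logMul_iterate_apply (f : ℕ → ℂ) (j n : ℕ) :
    LSeries.logMul^[j] f n = Complex.log n ^ j * f n := by
  induction j with
  | zero => simp
  | succ j ih =>
    rw [Function.iterate_succ_apply', LSeries.logMul, ih]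
    ring

lemma term_logMul_iterate (f : ℕ → ℝ) (j n : ℕ) {y : ℝ} (hf : f 0 = 0) :
    LSeries.term (LSeries.logMul^[j] fun n => (f n : ℂ)) (y : ℂ) n =
      ((f n * Real.log n ^ j / (n : ℝ) ^ y : ℝ) : ℂ) := by
  rcases eq_or_ne n 0 with rfl | hn
  · simp [hf]
  · rw [LSeries.term_of_ne_zero hn, logMul_iterate_apply]
    rw [Complex.ofReal_div, Complex.ofReal_cpow (Nat.cast_nonneg n)]
    push_cast
    ring

lemma iteratedDeriv_inv_sub_one (c : ℂ) (j : ℕ) (s : ℂ) :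
    iteratedDeriv j (fun s : ℂ => c / (s - 1)) s =
      c * ((-1) ^ j * j.factorial * (s - 1) ^ (-1 - j : ℤ)) := by
  simp only [div_eq_mul_inv]
  rw [iteratedDeriv_const_mul_field]
  congr 1
  have := congrFun (iteratedDeriv_comp_sub_const j (Inv.inv : ℂ → ℂ) 1) s
  refine this.trans ?_
  simp only [iteratedDeriv_eq_iterate, iter_deriv_inv']

open ArithmeticFunction.vonMangoldt in
lemma le_tsum_residueClass_mul_log_pow {q : ℕ} [NeZero q] {x K : ℝ} (hx : 0 < x)
    (hd : ∀ s : ℂ, ‖s - (1 + x : ℝ)‖ ≤ 2 * x →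
      DifferentiableAt ℂ (LFunctionResidueClassAux (1 : ZMod q)) s)
    (hK : ∀ s : ℂ, ‖s - (1 + x : ℝ)‖ ≤ 2 * x → ‖LFunctionResidueClassAux (1 : ZMod q) s‖ ≤ K)
    (j : ℕ) :
    j.factorial / (q.totient * x ^ (j + 1)) - j.factorial * K / (2 * x) ^ j ≤
      ∑' n : ℕ, residueClass (1 : ZMod q) n * Real.log n ^ j / (n : ℝ) ^ (1 + x) := by
  set E := LFunctionResidueClassAux (1 : ZMod q) with hE
  set f : ℕ → ℂ := fun n => (residueClass (1 : ZMod q) n : ℂ) with hf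
  set σ : ℂ := ((1 + x : ℝ) : ℂ) with hσ
  have hσre : 1 < σ.re := by rw [hσ, Complex.ofReal_re]; linarith
  have habs : LSeries.abscissaOfAbsConv f < σ.re :=
    (abscissaOfAbsConv_residueClass_le_one (1 : ZMod q)).trans_lt (by exact_mod_cast hσre)
  have hEv : LSeries f =ᶠ[nhds σ] fun s => E s + (q.totient : ℂ)⁻¹ / (s - 1) := by
    have ho : IsOpen {s : ℂ | 1 < s.re} := isOpen_lt continuous_const Complex.continuous_re
    filter_upwards [ho.mem_nhds hσre] with s hs
    have := eqOn_LFunctionResidueClassAux (q := q) (a := 1) isUnit_one hs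
    rw [hE, this]
    simp [hf]
  have hCD : ContDiffAt ℂ j E σ := by
    refine (DifferentiableOn.contDiffOn (s := Metric.ball σ (2 * x)) (fun z hz => ?_)
      Metric.isOpen_ball).contDiffAt (Metric.ball_mem_nhds _ (by positivity))
    exact (hd z (by simpa [dist_eq_norm] using (Metric.mem_ball.1 hz).le)).differentiableWithinAt
  have hσ1 : σ - 1 ≠ 0 := by
    intro h
    have := congrArg Complex.re h
    simp at this
    linarith
  have hCD2 : ContDiffAt ℂ j (fun s : ℂ => (q.totient : ℂ)⁻¹ / (s - 1)) σ :=
    contDiffAt_const.div (contDiffAt_id.sub contDiffAt_const) hσ1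
  have h1 : iteratedDeriv j (LSeries f) σ =
      iteratedDeriv j E σ + (q.totient : ℂ)⁻¹ *
        ((-1) ^ j * j.factorial * (σ - 1) ^ (-1 - j : ℤ)) := by
    rw [hEv.iteratedDeriv_eq, ← iteratedDeriv_inv_sub_one]
    exact iteratedDeriv_add hCD hCD2
  have hb : ‖iteratedDeriv j E σ‖ ≤ j.factorial * K / (2 * x) ^ j := by
    refine Complex.norm_iteratedDeriv_le_of_forall_mem_sphere_norm_le j (by positivity) ?_ ?_
    · refine DifferentiableOn.diffContOnCl fun z hz => ?_
      rw [closure_ball _ (by positivity)] at hz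
      exact (hd z (by simpa [dist_eq_norm] using hz)).differentiableWithinAt
    · intro z hz
      exact hK z (by simpa [dist_eq_norm] using (le_of_eq hz))
  rw [LSeries_iteratedDeriv j habs] at h1
  have h2 : LSeries (LSeries.logMul^[j] f) σ =
      ((∑' n : ℕ, residueClass (1 : ZMod q) n * Real.log n ^ j / (n : ℝ) ^ (1 + x) : ℝ) : ℂ) := by
    rw [LSeries, Complex.ofReal_tsum]
    exact tsum_congr fun n => term_logMul_iterate _ j n (residueClass_apply_zero _)
  have h3 : σ - 1 = (x : ℂ) := by simp [hσ]
  rw [h2, h3] at h1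
  set S : ℝ := ∑' n : ℕ, residueClass (1 : ZMod q) n * Real.log n ^ j / (n : ℝ) ^ (1 + x)
  have h4 : (S : ℂ) - (j.factorial / (q.totient * x ^ (j + 1)) : ℝ) =
      (-1) ^ j * iteratedDeriv j E σ := by
    have e : ((-1 : ℂ) ^ j) * (-1) ^ j = 1 := by rw [← mul_pow]; simp
    have e2 : (x : ℂ) ^ (-1 - j : ℤ) = ((x : ℂ) ^ (j + 1))⁻¹ := by
      rw [← zpow_natCast, ← zpow_neg]; congr 1; push_cast; ring
    rw [e2] at h1
    calc (S : ℂ) - (j.factorial / (q.totient * x ^ (j + 1)) : ℝ)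
        = (-1) ^ j * ((-1) ^ j * S) - (j.factorial / (q.totient * x ^ (j + 1)) : ℝ) := by
          rw [← mul_assoc, e, one_mul]
      _ = (-1) ^ j * iteratedDeriv j E σ +
          ((-1) ^ j * (-1) ^ j) * ((q.totient : ℂ)⁻¹ * (j.factorial * ((x : ℂ) ^ (j + 1))⁻¹)) -
          (j.factorial / (q.totient * x ^ (j + 1)) : ℝ) := by rw [h1]; ring
      _ = _ := by
        rw [e]; push_cast; rw [div_eq_mul_inv, mul_inv]; ring
  have h5 : |S - j.factorial / (q.totient * x ^ (j + 1))| ≤ j.factorial * K / (2 * x) ^ j := by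
    rw [← Complex.ofReal_sub] at h4
    rw [← Real.norm_eq_abs, ← Complex.norm_real, h4, norm_mul, norm_pow]
    simpa using hb
  have := (abs_le.1 h5).1
  linarith

open ArithmeticFunction.vonMangoldt in
lemma LFunctionResidueClassAux_one_bound {q : ℕ} [NeZero q] {s : ℂ} {B : ℝ}
    (h0 : DirichletCharacter.LFunctionTrivChar₁ q s ≠ 0)
    (h1 : ‖logDeriv (DirichletCharacter.LFunctionTrivChar₁ q) s‖ ≤ B)
    (h : ∀ χ : DirichletCharacter ℂ q, χ ≠ 1 → χ.LFunction s ≠ 0 ∧ ‖logDeriv χ.LFunction s‖ ≤ B) :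
    DifferentiableAt ℂ (LFunctionResidueClassAux (1 : ZMod q)) s ∧
      ‖LFunctionResidueClassAux (1 : ZMod q) s‖ ≤ B := by
  classical
  have hT : Differentiable ℂ (DirichletCharacter.LFunctionTrivChar₁ q) :=
    DirichletCharacter.differentiable_LFunctionTrivChar₁ q
  constructor
  · unfold LFunctionResidueClassAux
    refine DifferentiableAt.const_mul (DifferentiableAt.sub ?_ ?_) _
    · exact ((hT.contDiff.differentiable_deriv_two s).neg).div (hT s) h0
    · refine DifferentiableAt.fun_sum fun χ hχ => ?_
      have hχ1 : χ ≠ 1 := by simpa using hχ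
      have hD := DirichletCharacter.differentiable_LFunction hχ1
      exact ((hD.contDiff.differentiable_deriv_two s).const_mul _).div (hD s) (h χ hχ1).1
  · have hcard : Fintype.card (DirichletCharacter ℂ q) = q.totient := by
      rw [← Nat.card_eq_fintype_card]
      exact DirichletCharacter.card_eq_totient_of_hasEnoughRootsOfUnity ℂ q
    have hsum : ‖∑ χ ∈ ({1}ᶜ : Finset (DirichletCharacter ℂ q)),
        χ (1 : ZMod q)⁻¹ * deriv χ.LFunction s / χ.LFunction s‖ ≤ (q.totient - 1) * B := by
      have : (({1}ᶜ : Finset (DirichletCharacter ℂ q)).card : ℝ) = q.totient - 1 := by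
        rw [Finset.card_compl, hcard, Finset.card_singleton, Nat.cast_sub]
        · simp
        · exact Nat.totient_pos.2 (NeZero.pos q)
      rw [← this, ← nsmul_eq_mul]
      refine (norm_sum_le _ _).trans (Finset.sum_le_card_nsmul _ _ _ fun χ hχ => ?_)
      have hχ1 : χ ≠ 1 := by simpa using hχ
      rw [ZMod.inv_one, map_one, one_mul]
      exact (h χ hχ1).2
    have hq : (0 : ℝ) < q.totient := by exact_mod_cast Nat.totient_pos.2 (NeZero.pos q)
    unfold LFunctionResidueClassAux
    rw [norm_mul, norm_inv, Complex.norm_natCast, inv_mul_le_iff₀ hq]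
    refine (norm_sub_le _ _).trans ?_
    have e : ‖-deriv (DirichletCharacter.LFunctionTrivChar₁ q) s /
        DirichletCharacter.LFunctionTrivChar₁ q s‖ ≤ B := by
      rw [neg_div, norm_neg]; exact h1
    refine (add_le_add e ((le_of_eq ?_).trans hsum)).trans (le_of_eq (by ring))
    congr!

lemma exists_eq_sq_mul_cube {n : ℕ} (hn : IsPrimePow n) (hp : ¬ n.Prime) :
    ∃ w : ℕ × ℕ, n = w.1 ^ 2 * w.2 ^ 3 := by
  obtain ⟨p, k, hp', hk, rfl⟩ := hn
  rcases Nat.even_or_odd' k with ⟨i, rfl | rfl⟩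
  · exact ⟨(p ^ i, 1), by simp; ring⟩
  · rcases i with _ | i
    · exact absurd hp'.nat_prime (by simpa using hp)
    · exact ⟨(p ^ i, p), by simp; ring⟩

lemma summable_rpow_nonprime_isPrimePow :
    Summable fun n : ℕ => ({n : ℕ | IsPrimePow n ∧ ¬ n.Prime}).indicator
      (fun n : ℕ => (n : ℝ) ^ (-(3 / 4) : ℝ)) n := by
  rw [← summable_subtype_iff_indicator]
  choose w hw using fun n : {n : ℕ | IsPrimePow n ∧ ¬ n.Prime} =>
    exists_eq_sq_mul_cube n.2.1 n.2.2
  have hinj : Function.Injective w := fun a b h => Subtype.ext (by rw [hw a, hw b, h])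
  have h1 : Summable fun n : ℕ => (n : ℝ) ^ (-(3 / 2) : ℝ) :=
    Real.summable_nat_rpow.2 (by norm_num)
  have h2 : Summable fun n : ℕ => (n : ℝ) ^ (-(9 / 4) : ℝ) :=
    Real.summable_nat_rpow.2 (by norm_num)
  have h3 := h1.mul_of_nonneg h2 (fun n => by positivity) (fun n => by positivity)
  refine (h3.comp_injective hinj).congr fun n => ?_
  have e : ((n : ℕ) : ℝ) = (w n).1 ^ 2 * (w n).2 ^ 3 := by exact_mod_cast hw n
  simp only [Function.comp]
  rw [e, Real.mul_rpow (by positivity) (by positivity), ← Real.rpow_natCast, ← Real.rpow_natCast,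
    ← Real.rpow_mul (by positivity), ← Real.rpow_mul (by positivity)]
  norm_num

lemma pow_le_factorial_div_mul_exp {z t : ℝ} (hz : 0 < z) (ht : 0 ≤ t) (k : ℕ) :
    t ^ k ≤ k.factorial / z ^ k * Real.exp (z * t) := by
  have h := Real.pow_div_factorial_le_exp (z * t) (by positivity) k
  rw [div_le_iff₀ (by positivity), mul_pow] at h
  rw [div_mul_eq_mul_div, le_div_iff₀ (by positivity)]
  linarith

lemma log_pow_le_factorial_div_mul_rpow {z : ℝ} (hz : 0 < z) {n : ℕ} (hn : n ≠ 0) (k : ℕ) :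
    Real.log n ^ k ≤ k.factorial / z ^ k * (n : ℝ) ^ z := by
  have hn' : (0 : ℝ) < n := by positivity
  rw [Real.rpow_def_of_pos hn', mul_comm (Real.log n)]
  exact pow_le_factorial_div_mul_exp hz (Real.log_natCast_nonneg n) k

/-- The sum of `n ^ (-3/4)` over prime powers which are not primes. -/
noncomputable def nonprimePrimePowSum : ℝ :=
  ∑' n : ℕ, ({n : ℕ | IsPrimePow n ∧ ¬ n.Prime}).indicator
    (fun n : ℕ => (n : ℝ) ^ (-(3 / 4) : ℝ)) n

/-- The weight `(log n) ^ k / n ^ y` restricted to primes. -/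
noncomputable def primeLogTerm (k : ℕ) (y : ℝ) (n : ℕ) : ℝ :=
  if n.Prime then Real.log n ^ k / (n : ℝ) ^ y else 0

lemma primeLogTerm_nonneg (k : ℕ) (y : ℝ) (n : ℕ) : 0 ≤ primeLogTerm k y n := by
  unfold primeLogTerm
  split_ifs
  · have := Real.log_natCast_nonneg n
    positivity
  · exact le_rfl

lemma primeLogTerm_le {k : ℕ} {y z : ℝ} (hz : 0 < z) (n : ℕ) :
    primeLogTerm k y n ≤ k.factorial / z ^ k * (n : ℝ) ^ (z - y) := by
  unfold primeLogTerm
  split_ifs with h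
  · have hn : (0 : ℝ) < n := by exact_mod_cast h.pos
    rw [Real.rpow_sub hn, ← mul_div_assoc]
    gcongr
    exact log_pow_le_factorial_div_mul_rpow hz h.ne_zero k
  · positivity

lemma summable_primeLogTerm (k : ℕ) {y : ℝ} (hy : 1 < y) : Summable (primeLogTerm k y) := by
  refine Summable.of_nonneg_of_le (primeLogTerm_nonneg k y)
    (primeLogTerm_le (z := (y - 1) / 2) (by linarith)) (Summable.mul_left _ ?_)
  exact Real.summable_nat_rpow.2 (by linarith)

open ArithmeticFunction.vonMangoldt in
lemma tsum_residueClass_le {q : ℕ} [NeZero q] {x : ℝ} (hx : 0 < x) (j : ℕ) :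
    ∑' n : ℕ, residueClass (1 : ZMod q) n * Real.log n ^ j / (n : ℝ) ^ (1 + x) ≤
      ∑' s : ℕ, primeLogTerm (j + 1) (1 + x) (q * s + 1) +
        (j + 1).factorial * 4 ^ (j + 1) * nonprimePrimePowSum := by
  classical
  set g : ℕ → ℝ := ({n : ℕ | (n : ZMod q) = 1}).indicator (primeLogTerm (j + 1) (1 + x)) with hg
  set h : ℕ → ℝ := ({n : ℕ | IsPrimePow n ∧ ¬ n.Prime}).indicator
      (fun n : ℕ => (n : ℝ) ^ (-(3 / 4) : ℝ)) with hh
  have hgs : Summable g := (summable_primeLogTerm (j + 1) (by linarith)).indicator _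
  have hhs : Summable h := summable_rpow_nonprime_isPrimePow
  have hg_tsum : ∑' n, g n = ∑' s : ℕ, primeLogTerm (j + 1) (1 + x) (q * s + 1) := by
    have hinj : Function.Injective fun s : ℕ => q * s + 1 := fun a b hab => by
      simpa [NeZero.ne q] using hab
    rw [← hinj.tsum_eq]
    · refine tsum_congr fun s => ?_
      rw [hg, Set.indicator_of_mem]
      simp
    · intro n hn
      have hn1 : (n : ZMod q) = 1 := by
        by_contra hc
        exact hn (Set.indicator_of_notMem (s := {n : ℕ | (n : ZMod q) = 1}) (by exact hc) _)
      have hnp : n.Prime := by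
        by_contra hc
        refine hn ?_
        simp [hg, Set.indicator_apply, primeLogTerm, hc]
      have h1 : 1 ≡ n [MOD q] := ((ZMod.natCast_eq_natCast_iff _ _ _).1 (by simpa using hn1)).symm
      obtain ⟨s, hs⟩ := (Nat.modEq_iff_dvd' hnp.pos).1 h1
      exact ⟨s, by have := hnp.pos; simp only; omega⟩
  have key : ∀ n : ℕ, residueClass (1 : ZMod q) n * Real.log n ^ j / (n : ℝ) ^ (1 + x) ≤
      g n + (j + 1).factorial * 4 ^ (j + 1) * h n := by
    intro n
    have hg0 : 0 ≤ g n := Set.indicator_nonneg (fun n _ => primeLogTerm_nonneg _ _ n) n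
    have hh0 : 0 ≤ h n := Set.indicator_nonneg (fun n _ => by positivity) n
    have hlog := Real.log_natCast_nonneg n
    by_cases hpp : IsPrimePow n
    · have hn0 : (0 : ℝ) < n := by exact_mod_cast hpp.pos
      have hn1 : (1 : ℝ) ≤ n := by exact_mod_cast hpp.pos
      by_cases hp : n.Prime
      · by_cases h1 : (n : ZMod q) = 1
        · have e1 : residueClass (1 : ZMod q) n = Real.log n := by
            unfold residueClass
            rw [Set.indicator_of_mem (by exact h1), ArithmeticFunction.vonMangoldt_apply_prime hp]
          have e2 : g n = Real.log n ^ (j + 1) / (n : ℝ) ^ (1 + x) := by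
            rw [hg, Set.indicator_of_mem (by exact h1), primeLogTerm, if_pos hp]
          rw [e1, e2, pow_succ']
          have : 0 ≤ ((j + 1).factorial * 4 ^ (j + 1) * h n : ℝ) := by positivity
          linarith
        · have e1 : residueClass (1 : ZMod q) n = 0 := by
            unfold residueClass
            rw [Set.indicator_of_notMem (by exact h1)]
          rw [e1, zero_mul, zero_div]
          positivity
      · have e : h n = (n : ℝ) ^ (-(3 / 4) : ℝ) := by
          rw [hh, Set.indicator_of_mem (by exact ⟨hpp, hp⟩)]
        have b1 : residueClass (1 : ZMod q) n ≤ Real.log n :=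
          (residueClass_le _ n).trans ArithmeticFunction.vonMangoldt_le_log
        have b2 : Real.log n ^ (j + 1) ≤
            (j + 1).factorial * 4 ^ (j + 1) * (n : ℝ) ^ (1 / 4 : ℝ) := by
          have := log_pow_le_factorial_div_mul_rpow (z := 1 / 4) (by norm_num) hpp.ne_zero (j + 1)
          refine this.trans (le_of_eq ?_)
          rw [one_div, inv_pow, div_inv_eq_mul]
        have b3 : (n : ℝ) ≤ (n : ℝ) ^ (1 + x) := by
          conv_lhs => rw [← Real.rpow_one (n : ℝ)]
          exact Real.rpow_le_rpow_of_exponent_le hn1 (by linarith)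
        calc residueClass (1 : ZMod q) n * Real.log n ^ j / (n : ℝ) ^ (1 + x)
            ≤ Real.log n * Real.log n ^ j / n := by gcongr
          _ = Real.log n ^ (j + 1) / n := by rw [pow_succ']
          _ ≤ (j + 1).factorial * 4 ^ (j + 1) * (n : ℝ) ^ (1 / 4 : ℝ) / n := by gcongr
          _ = (j + 1).factorial * 4 ^ (j + 1) * h n := by
            rw [e, mul_div_assoc]
            congr 1
            conv_lhs => rw [← Real.rpow_one (n : ℝ), ← Real.rpow_mul (by positivity),
              one_mul, ← Real.rpow_sub hn0]
            norm_num
          _ ≤ _ := by linarith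
    · have e1 : residueClass (1 : ZMod q) n = 0 :=
        le_antisymm ((residueClass_le _ n).trans
          (ArithmeticFunction.vonMangoldt_eq_zero_iff.2 hpp).le) (residueClass_nonneg _ n)
      rw [e1, zero_mul, zero_div]
      positivity
  have hsum := hgs.add (hhs.mul_left ((j + 1).factorial * 4 ^ (j + 1) : ℝ))
  rw [← hg_tsum, nonprimePrimePowSum, ← tsum_mul_left, ← hgs.tsum_add (hhs.mul_left _)]
  refine Summable.tsum_le_tsum key (Summable.of_nonneg_of_le (fun n => ?_) key hsum) hsum
  have := residueClass_nonneg (1 : ZMod q) n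
  have := Real.log_natCast_nonneg n
  positivity

lemma sum_mul_tsum_primeLogTerm_le {D : Finset ℕ} {m : ℕ} {l x : ℝ} (hx : 0 < x) (hx1 : x ≤ 1)
    (hxl : x * l ≤ 1) (hD : ∀ d ∈ D, 0 < d ∧ Real.log (d + 1) ≤ l)
    (hm : ∀ s : ℕ, 1 ≤ s → (D.filter fun d => (d * s + 1).Prime).card ≤ m) (j : ℕ) :
    ∑ d ∈ D, (d : ℝ) * ∑' s : ℕ, primeLogTerm (j + 1) (1 + x) (d * s + 1) ≤
      m * ((j + 1).factorial * Real.exp 2 * (j + 3) / x ^ (j + 2)) := by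
  have hj : (0 : ℝ) < j + 1 := by positivity
  set z : ℝ := x * (j + 1) / (j + 2) with hz
  have hz0 : 0 < z := by positivity
  have hzx : x - z = x / (j + 2) := by rw [hz]; field_simp; ring
  have hzx' : z ≤ x := by
    have : 0 < x / (j + 2) := by positivity
    linarith
  set F : ℝ := (j + 1).factorial / z ^ (j + 1) * Real.exp (z * l) with hF
  have hF0 : 0 ≤ F := by positivity
  have bound : ∀ d ∈ D, ∀ s : ℕ, (d : ℝ) * primeLogTerm (j + 1) (1 + x) (d * (s + 1) + 1) ≤
      F * (1 / ((s : ℝ) + 1) ^ (1 + (x - z))) := by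
    intro d hd s
    obtain ⟨hd0, hdl⟩ := hD d hd
    have hd1 : (0 : ℝ) < d := by exact_mod_cast hd0
    unfold primeLogTerm
    split_ifs with hp
    · have hs : (0 : ℝ) < (s : ℝ) + 1 := by positivity
      have hs1 : (1 : ℝ) ≤ (s : ℝ) + 1 := by linarith [Nat.cast_nonneg (α := ℝ) s]
      have e : ((d * (s + 1) + 1 : ℕ) : ℝ) = d * (s + 1) + 1 := by push_cast; ring
      rw [e]
      have h1 : Real.log (d * (s + 1) + 1) ≤ Real.log (s + 1) + l := by
        calc Real.log (d * (s + 1) + 1) ≤ Real.log ((s + 1) * (d + 1)) := by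
              refine Real.log_le_log (by positivity) ?_
              nlinarith
          _ = Real.log (s + 1) + Real.log (d + 1) := Real.log_mul hs.ne' (by positivity)
          _ ≤ _ := by linarith
      have h0 : 0 ≤ Real.log (d * (s + 1) + 1) := Real.log_nonneg (by nlinarith)
      have h2 : Real.log (d * (s + 1) + 1) ^ (j + 1) ≤ F * ((s : ℝ) + 1) ^ z := by
        calc Real.log (d * (s + 1) + 1) ^ (j + 1) ≤ (Real.log (s + 1) + l) ^ (j + 1) := by gcongr
          _ ≤ (j + 1).factorial / z ^ (j + 1) * Real.exp (z * (Real.log (s + 1) + l)) :=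
              pow_le_factorial_div_mul_exp hz0 (h0.trans h1) _
          _ = _ := by
            rw [mul_add, Real.exp_add, hF, Real.rpow_def_of_pos hs, mul_comm (Real.log _) z]
            ring
      have h3 : (d : ℝ) * ((s : ℝ) + 1) ^ (1 + x) ≤ ((d : ℝ) * (s + 1) + 1) ^ (1 + x) := by
        have hd2 : (1 : ℝ) ≤ d := by exact_mod_cast hd0
        calc (d : ℝ) * ((s : ℝ) + 1) ^ (1 + x) ≤ (d : ℝ) ^ (1 + x) * ((s : ℝ) + 1) ^ (1 + x) := by
              gcongr
              conv_lhs => rw [← Real.rpow_one (d : ℝ)]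
              exact Real.rpow_le_rpow_of_exponent_le hd2 (by linarith)
          _ = ((d : ℝ) * (s + 1)) ^ (1 + x) := (Real.mul_rpow hd1.le hs.le).symm
          _ ≤ _ := by gcongr; linarith
      calc (d : ℝ) * (Real.log (d * (s + 1) + 1) ^ (j + 1) / ((d : ℝ) * (s + 1) + 1) ^ (1 + x))
          ≤ (d : ℝ) * (F * ((s : ℝ) + 1) ^ z / ((d : ℝ) * ((s : ℝ) + 1) ^ (1 + x))) := by
            gcongr
        _ = F * (((s : ℝ) + 1) ^ z / ((s : ℝ) + 1) ^ (1 + x)) := by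
            field_simp
        _ = _ := by
            rw [← Real.rpow_sub hs, one_div, ← Real.rpow_neg hs.le]
            congr 2
            ring
    · rw [mul_zero]
      positivity
  have hsumm : Summable fun s : ℕ => F * (1 / ((s : ℝ) + 1) ^ (1 + (x - z))) := by
    refine Summable.mul_left _ (summable_one_div_add_one_rpow ?_)
    rw [hzx]
    positivity
  have hsd : ∀ d ∈ D, Summable fun s : ℕ =>
      (d : ℝ) * primeLogTerm (j + 1) (1 + x) (d * (s + 1) + 1) := fun d hd =>
    Summable.of_nonneg_of_le
      (fun s => mul_nonneg (Nat.cast_nonneg _) (primeLogTerm_nonneg _ _ _)) (bound d hd) hsumm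
  have h1 : ∀ d ∈ D, (d : ℝ) * ∑' s : ℕ, primeLogTerm (j + 1) (1 + x) (d * s + 1) =
      ∑' s : ℕ, (d : ℝ) * primeLogTerm (j + 1) (1 + x) (d * (s + 1) + 1) := by
    intro d hd
    have hinj : Function.Injective fun s : ℕ => d * s + 1 := fun a b hab => by
      simpa [(hD d hd).1.ne'] using hab
    have hs : Summable fun s : ℕ => primeLogTerm (j + 1) (1 + x) (d * s + 1) :=
      (summable_primeLogTerm (j + 1) (y := 1 + x) (by linarith)).comp_injective hinj
    rw [hs.tsum_eq_zero_add, tsum_mul_left]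
    simp [primeLogTerm, Nat.not_prime_one]
  rw [Finset.sum_congr rfl h1, ← Summable.tsum_finsetSum hsd]
  have h2 : ∀ s : ℕ, ∑ d ∈ D, (d : ℝ) * primeLogTerm (j + 1) (1 + x) (d * (s + 1) + 1) ≤
      m * (F * (1 / ((s : ℝ) + 1) ^ (1 + (x - z)))) := by
    intro s
    have hB : 0 ≤ F * (1 / ((s : ℝ) + 1) ^ (1 + (x - z))) := by positivity
    calc ∑ d ∈ D, (d : ℝ) * primeLogTerm (j + 1) (1 + x) (d * (s + 1) + 1)
        = ∑ d ∈ D.filter fun d => (d * (s + 1) + 1).Prime,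
            (d : ℝ) * primeLogTerm (j + 1) (1 + x) (d * (s + 1) + 1) := by
          rw [Finset.sum_filter]
          refine Finset.sum_congr rfl fun d _ => ?_
          split_ifs with h
          · rfl
          · simp [primeLogTerm, h]
      _ ≤ (D.filter fun d => (d * (s + 1) + 1).Prime).card •
            (F * (1 / ((s : ℝ) + 1) ^ (1 + (x - z)))) :=
          Finset.sum_le_card_nsmul _ _ _ fun d hd => bound d (Finset.mem_filter.1 hd).1 s
      _ ≤ _ := by
          rw [nsmul_eq_mul]
          gcongr
          exact hm (s + 1) (by omega)
  refine (Summable.tsum_le_tsum h2 (summable_sum hsd) (hsumm.mul_left _)).trans ?_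
  rw [tsum_mul_left, tsum_mul_left]
  refine mul_le_mul_of_nonneg_left ?_ (Nat.cast_nonneg m)
  have h3 : ∑' s : ℕ, 1 / ((s : ℝ) + 1) ^ (1 + (x - z)) ≤ (j + 3) / x := by
    have hpos : 0 < x - z := by rw [hzx]; positivity
    refine (tsum_one_div_rpow_le hpos).trans ?_
    rw [hzx, one_div_div, ← sub_nonneg]
    have : (j + 3) / x - (1 + (j + 2) / x) = (1 - x) / x := by field_simp; ring
    rw [this]
    exact div_nonneg (by linarith) hx.le
  have h4 : F ≤ (j + 1).factorial * Real.exp 2 / x ^ (j + 1) := by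
    have e1 : Real.exp (z * l) ≤ Real.exp 1 := by
      refine Real.exp_le_exp.2 ?_
      rcases le_total 0 l with h | h
      · exact (mul_le_mul_of_nonneg_right hzx' h).trans hxl
      · nlinarith
    have e2 : 1 / z ^ (j + 1) ≤ Real.exp 1 / x ^ (j + 1) := by
      have e3 : (1 / z) = (1 / x) * (1 + 1 / (j + 1)) := by rw [hz]; field_simp; ring
      have e4 : (1 + 1 / ((j : ℝ) + 1)) ^ (j + 1) ≤ Real.exp 1 := by
        calc (1 + 1 / ((j : ℝ) + 1)) ^ (j + 1) ≤ (Real.exp (1 / ((j : ℝ) + 1))) ^ (j + 1) := by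
              gcongr
              rw [add_comm]
              exact Real.add_one_le_exp _
          _ = Real.exp 1 := by
              rw [← Real.exp_nat_mul]
              congr 1
              push_cast
              field_simp
      calc 1 / z ^ (j + 1) = (1 / z) ^ (j + 1) := by rw [one_div_pow]
        _ = (1 / x) ^ (j + 1) * (1 + 1 / ((j : ℝ) + 1)) ^ (j + 1) := by rw [e3, mul_pow]
        _ ≤ (1 / x) ^ (j + 1) * Real.exp 1 := by gcongr
        _ = _ := by rw [one_div_pow]; ring
    calc F = (j + 1).factorial * (1 / z ^ (j + 1)) * Real.exp (z * l) := by rw [hF]; ring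
      _ ≤ (j + 1).factorial * (Real.exp 1 / x ^ (j + 1)) * Real.exp 1 := by gcongr
      _ = (j + 1).factorial * (Real.exp 1 * Real.exp 1) / x ^ (j + 1) := by ring
      _ = _ := by rw [← Real.exp_add]; norm_num
  calc F * ∑' s : ℕ, 1 / ((s : ℝ) + 1) ^ (1 + (x - z))
      ≤ ((j + 1).factorial * Real.exp 2 / x ^ (j + 1)) * ((j + 3) / x) := by gcongr
    _ = _ := by rw [pow_succ x (j + 1)]; field_simp

lemma exists_le_mul_tsum_primeLogTerm : ∃ c : ℝ, 0 < c ∧ c ≤ 1 / 16 ∧ ∀ (d : ℕ) [NeZero d],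
    ∃ L₀ : ℕ, 2 ≤ L₀ ∧ ∀ L : ℕ, L₀ ≤ L → ∀ (e : ℕ), e ≠ 0 → Odd e →
    e.primeFactors ⊆ d.primeFactors → d * e ≤ 2 ^ L →
    (2 * L).factorial / (2 * (c / (L : ℝ) ^ 9) ^ (2 * L + 1)) ≤
      ((d * e : ℕ) : ℝ) *
        ∑' s : ℕ, primeLogTerm (2 * L + 1) (1 + c / (L : ℝ) ^ 9) (d * e * s + 1) := by
  obtain ⟨c, hc0, hc, H⟩ := exists_norm_logDeriv_le
  refine ⟨c, hc0, hc, fun d _ => ?_⟩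
  obtain ⟨l₀, -, H⟩ := H d
  refine ⟨max 2 (max ⌈l₀⌉₊ ⌈4 * nonprimePrimePowSum⌉₊), le_max_left _ _,
    fun L hL e he0 heo hed hde => ?_⟩
  have hL2 : 2 ≤ L := (le_max_left _ _).trans hL
  have hLl : l₀ ≤ L := (Nat.le_ceil _).trans (by
    exact_mod_cast ((le_max_left _ _).trans (le_max_right _ _)).trans hL)
  have hLS : 4 * nonprimePrimePowSum ≤ L := (Nat.le_ceil _).trans (by
    exact_mod_cast ((le_max_right _ _).trans (le_max_right _ _)).trans hL)
  have : NeZero (d * e) := ⟨mul_ne_zero (NeZero.ne d) he0⟩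
  set q := d * e with hq
  have hq0 : (0 : ℝ) < q := by exact_mod_cast NeZero.pos q
  have hqL : (q : ℝ) ≤ 2 ^ L := by exact_mod_cast hde
  have hlog : Real.log q ≤ L := by
    calc Real.log q ≤ Real.log (2 ^ L) := Real.log_le_log hq0 hqL
      _ = L * Real.log 2 := Real.log_pow _ _
      _ ≤ L * 1 := by
        gcongr
        linarith [Real.log_two_lt_d9]
      _ = L := mul_one _
  have H' := H L hLl e heo hed hlog
  set x : ℝ := c / (L : ℝ) ^ 9 with hx
  have hL1 : (2 : ℝ) ≤ L := by exact_mod_cast hL2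
  have hx0 : 0 < x := by positivity
  have hx16 : x ≤ 1 / 16 := (div_le_self hc0.le (one_le_pow₀ (by linarith))).trans hc
  have hbd : ∀ s : ℂ, ‖s - (1 + x : ℝ)‖ ≤ 2 * x → _ := fun s hs =>
    LFunctionResidueClassAux_one_bound (H' s (by exact_mod_cast hs)).1.1
      (H' s (by exact_mod_cast hs)).1.2 (H' s (by exact_mod_cast hs)).2
  have h1 := le_tsum_residueClass_mul_log_pow hx0 (fun s hs => (hbd s hs).1)
    (fun s hs => (hbd s hs).2) (2 * L)
  have h2 := h1.trans (tsum_residueClass_le hx0 (2 * L))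
  set S : ℝ := ∑' s : ℕ, primeLogTerm (2 * L + 1) (1 + x) (q * s + 1) with hS
  have hC0 : 0 ≤ nonprimePrimePowSum :=
    tsum_nonneg fun n => Set.indicator_nonneg (fun n _ => by positivity) n
  have hφ0 : (0 : ℝ) < q.totient := by exact_mod_cast Nat.totient_pos.2 (NeZero.pos q)
  have hφ : (q.totient : ℝ) ≤ q := by exact_mod_cast Nat.totient_le q
  have hA : (0 : ℝ) < (2 * L).factorial / x ^ (2 * L + 1) := by positivity
  set A : ℝ := (2 * L).factorial / x ^ (2 * L + 1) with hAdef
  have h2L : (L : ℝ) ≤ 2 ^ L := by exact_mod_cast Nat.lt_two_pow_self.le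
  have t1 : A ≤ q * ((2 * L).factorial / (q.totient * x ^ (2 * L + 1))) := by
    have e1 : (q : ℝ) * ((2 * L).factorial / (q.totient * x ^ (2 * L + 1))) =
        q / q.totient * A := by rw [hAdef]; field_simp
    rw [e1]
    exact le_mul_of_one_le_left hA.le ((one_le_div hφ0).2 hφ)
  have t2 : q * ((2 * L).factorial * (1 / x) / (2 * x) ^ (2 * L)) ≤ A * (1 / 4) := by
    have e1 : q * ((2 * L).factorial * (1 / x) / (2 * x) ^ (2 * L)) =
        A * (q / (2 ^ L * 2 ^ L)) := by
      rw [hAdef, mul_pow, pow_succ x, two_mul L, pow_add 2 L L]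
      field_simp
    rw [e1]
    refine mul_le_mul_of_nonneg_left ?_ hA.le
    rw [div_le_iff₀ (by positivity)]
    have : (4 : ℝ) ≤ 2 ^ L := by
      calc (4 : ℝ) = 2 ^ 2 := by norm_num
        _ ≤ 2 ^ L := pow_le_pow_right₀ (by norm_num) hL2
    nlinarith [pow_pos (two_pos (α := ℝ)) L]
  have t3 : q * ((2 * L + 1).factorial * 4 ^ (2 * L + 1) * nonprimePrimePowSum) ≤ A * (1 / 4) := by
    have e1 : q * ((2 * L + 1).factorial * 4 ^ (2 * L + 1) * nonprimePrimePowSum) =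
        A * (q * ((2 * L + 1) * nonprimePrimePowSum * (4 * x) ^ (2 * L + 1))) := by
      rw [hAdef, mul_pow, Nat.factorial_succ]
      push_cast
      field_simp
    rw [e1]
    refine mul_le_mul_of_nonneg_left ?_ hA.le
    have e2 : (4 * x) ^ (2 * L + 1) ≤ (1 / 4) * ((1 / 2 ^ L) * (1 / 2 ^ L) * (1 / 4 ^ L)) := by
      calc (4 * x) ^ (2 * L + 1) ≤ (1 / 4) ^ (2 * L + 1) := by gcongr; linarith
        _ = _ := by
          rw [pow_succ', two_mul, pow_add]
          congr 1
          have h4 : (4 : ℝ) ^ L = 2 ^ L * 2 ^ L := by rw [← mul_pow]; norm_num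
          rw [one_div_pow, h4]
          field_simp
    have e3 : (2 * L + 1 : ℝ) ≤ 4 ^ L := by
      have : (1 : ℝ) + L * 3 ≤ (1 + 3) ^ L := one_add_mul_le_pow (by norm_num) L
      norm_num at this
      linarith
    calc q * ((2 * L + 1) * nonprimePrimePowSum * (4 * x) ^ (2 * L + 1))
        ≤ 2 ^ L * (4 ^ L * (2 ^ L / 4) * ((1 / 4) * ((1 / 2 ^ L) * (1 / 2 ^ L) * (1 / 4 ^ L)))) := by
          gcongr
          linarith
      _ = 1 / 16 := by field_simp; norm_num
      _ ≤ 1 / 4 := by norm_num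
  have h3 := mul_le_mul_of_nonneg_left h2 hq0.le
  rw [mul_sub, mul_add] at h3
  have e : (2 * L).factorial / (2 * x ^ (2 * L + 1)) = A / 2 := by
    rw [hAdef]; field_simp
  rw [e]
  linarith

lemma succ_pow_le_card_divisors_pow {P : ℕ} (hP : P ≠ 0) (T : ℕ) :
    (T + 1) ^ P.primeFactors.card ≤ (P ^ T).divisors.card := by
  rcases eq_or_ne T 0 with rfl | hT
  · simp
  · rw [Nat.card_divisors (pow_ne_zero _ hP), Nat.primeFactors_pow _ hT]
    refine Finset.pow_card_le_prod _ _ _ fun p hp => ?_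
    have := (Nat.prime_of_mem_primeFactors hp).factorization_pos_of_dvd hP
      (Nat.dvd_of_mem_primeFactors hp)
    simp only [Nat.factorization_pow, Finsupp.smul_apply, smul_eq_mul]
    nlinarith

lemma primeFactors_subset_of_dvd_pow {P e T : ℕ} (hP : P ≠ 0) (h : e ∣ P ^ T) :
    e.primeFactors ⊆ P.primeFactors := fun p hp => by
  have hp' := Nat.prime_of_mem_primeFactors hp
  exact Nat.mem_primeFactors.2
    ⟨hp', hp'.dvd_of_dvd_pow ((Nat.dvd_of_mem_primeFactors hp).trans h), hP⟩

lemma exists_card_filter_prime_gt {P : ℕ} (hPo : Odd P) (hP : 12 ≤ P.primeFactors.card)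
    {N : ℕ} (hN : N ≠ 0) (m : ℕ) :
    ∃ T s : ℕ, 1 ≤ s ∧ m < ((P ^ T).divisors.filter fun e => (P ^ N * e * s + 1).Prime).card := by
  have hP0 : P ≠ 0 := by rintro rfl; simp at hP
  have hP2 : 2 ≤ P := by
    rcases P with _ | _ | P
    · simp at hP
    · simp at hP
    · omega
  have : NeZero (P ^ N) := ⟨pow_ne_zero _ hP0⟩
  obtain ⟨c, hc0, hc, H⟩ := exists_le_mul_tsum_primeLogTerm
  obtain ⟨L₀, hL₀, H⟩ := H (P ^ N)
  set c₀ : ℕ := P * (N + 2) with hc₀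
  have hc₀1 : 1 ≤ c₀ := Nat.mul_pos (by omega) (by omega)
  by_contra! hcon
  set K : ℝ := 30 * m * Real.exp 2 * (c₀ : ℝ) ^ 11 / c with hK
  obtain ⟨T, hT⟩ := exists_nat_gt (max K L₀)
  have hTK : K < T := (le_max_left _ _).trans_lt hT
  have hTL : L₀ < T := by exact_mod_cast (le_max_right _ _).trans_lt hT
  set L := c₀ * T with hL
  have hTleL : T ≤ L := Nat.le_mul_of_pos_left T hc₀1
  have hL2 : (2 : ℝ) ≤ L := by exact_mod_cast (by omega : 2 ≤ L)
  set x : ℝ := c / (L : ℝ) ^ 9 with hx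
  have hx0 : 0 < x := by positivity
  have hxc : x ≤ c := div_le_self hc0.le (one_le_pow₀ (by linarith))
  have hxL : x * L ≤ 1 := by
    have : x * L = c / (L : ℝ) ^ 8 := by rw [hx]; field_simp
    rw [this]
    exact (div_le_self hc0.le (one_le_pow₀ (by linarith))).trans (by linarith)
  have hbound : ∀ e ∈ (P ^ T).divisors, P ^ N * e + 1 ≤ 2 ^ L := by
    intro e he
    have he' := Nat.divisor_le he
    calc P ^ N * e + 1 ≤ P ^ N * P ^ T + 1 := by gcongr
      _ ≤ P ^ N * P ^ T * 2 := by
        have : 0 < P ^ N * P ^ T := by positivity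
        omega
      _ ≤ P ^ N * P ^ T * P := by gcongr
      _ = P ^ (N + T + 1) := by ring
      _ ≤ P ^ ((N + 2) * T) := Nat.pow_le_pow_right (by omega) (by nlinarith)
      _ ≤ (2 ^ P) ^ ((N + 2) * T) := Nat.pow_le_pow_left Nat.lt_two_pow_self.le _
      _ = 2 ^ L := by rw [← pow_mul, hL, hc₀]; ring_nf
  have hinj : Function.Injective fun e => P ^ N * e := fun a b h =>
    Nat.eq_of_mul_eq_mul_left (NeZero.pos (P ^ N)) h
  set D := (P ^ T).divisors.image fun e => P ^ N * e with hD
  have hup := sum_mul_tsum_primeLogTerm_le (D := D) (m := m) (l := L) hx0 (by linarith) hxL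
    (by
      intro d hd
      obtain ⟨e, he, rfl⟩ := Finset.mem_image.1 hd
      refine ⟨Nat.mul_pos (NeZero.pos _) (Nat.pos_of_mem_divisors he), ?_⟩
      have h1 : ((P ^ N * e : ℕ) : ℝ) + 1 ≤ 2 ^ L := by exact_mod_cast hbound e he
      calc Real.log (((P ^ N * e : ℕ) : ℝ) + 1) ≤ Real.log (2 ^ L) :=
            Real.log_le_log (by positivity) h1
        _ = L * Real.log 2 := Real.log_pow _ _
        _ ≤ L * 1 := by
          gcongr
          linarith [Real.log_two_lt_d9]
        _ = L := mul_one _)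
    (by
      intro s hs
      rw [hD, Finset.filter_image, Finset.card_image_of_injective _ hinj]
      exact hcon T s hs) (2 * L)
  rw [hD, Finset.sum_image hinj.injOn] at hup
  have hlow : (P ^ T).divisors.card • ((2 * L).factorial / (2 * x ^ (2 * L + 1))) ≤
      ∑ e ∈ (P ^ T).divisors, ((P ^ N * e : ℕ) : ℝ) *
        ∑' s : ℕ, primeLogTerm (2 * L + 1) (1 + x) (P ^ N * e * s + 1) := by
    refine Finset.card_nsmul_le_sum _ _ _ fun e he => ?_
    have hdvd := Nat.dvd_of_mem_divisors he
    refine H L (by omega) e (Nat.pos_of_mem_divisors he).ne' ((hPo.pow).of_dvd_nat hdvd) ?_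
      ((Nat.le_succ _).trans (hbound e he))
    rw [Nat.primeFactors_pow _ hN]
    exact primeFactors_subset_of_dvd_pow hP0 hdvd
  have h := hlow.trans hup
  rw [nsmul_eq_mul] at h
  have hcard : (T : ℝ) ^ 12 ≤ (P ^ T).divisors.card := by
    have h1 : T ^ 12 ≤ (P ^ T).divisors.card :=
      calc T ^ 12 ≤ (T + 1) ^ 12 := Nat.pow_le_pow_left (by omega) _
        _ ≤ (T + 1) ^ P.primeFactors.card := Nat.pow_le_pow_right (by omega) hP
        _ ≤ _ := succ_pow_le_card_divisors_pow hP0 T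
    exact_mod_cast h1
  have hT0 : (0 : ℝ) < T := by exact_mod_cast (by omega : 0 < T)
  have hmain : ((P ^ T).divisors.card : ℝ) ≤ K * T ^ 11 := by
    have e1 : (m : ℝ) * ((2 * L + 1).factorial * Real.exp 2 * ((2 * L : ℕ) + 3) /
        x ^ (2 * L + 2)) = (m * (2 * L + 1) * (2 * L + 3) * Real.exp 2 * 2 / x) *
          ((2 * L).factorial / (2 * x ^ (2 * L + 1))) := by
      rw [Nat.factorial_succ, pow_succ x (2 * L + 1)]
      push_cast
      field_simp
    rw [e1] at h
    refine (le_of_mul_le_mul_right h (by positivity)).trans ?_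
    have e2 : m * (2 * L + 1) * (2 * L + 3) * Real.exp 2 * 2 / x =
        (m * Real.exp 2 * 2 / c) * ((2 * L + 1) * (2 * L + 3) * (L : ℝ) ^ 9) := by
      rw [hx]; field_simp
    have e3 : K * T ^ 11 = (m * Real.exp 2 * 2 / c) * ((3 * L) * (5 * L) * (L : ℝ) ^ 9) := by
      rw [hK, hL]; push_cast; ring
    rw [e2, e3]
    gcongr <;> linarith
  have h12 : (T : ℝ) ^ 12 ≤ K * T ^ 11 := hcard.trans hmain
  rw [pow_succ' (T : ℝ) 11] at h12
  exact absurd (le_of_mul_le_mul_right h12 (by positivity)) (not_le.2 hTK)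

lemma exists_prime_mul_add_one (N m : ℕ) : ∃ (a s : ℕ) (S : Finset ℕ), 1 ≤ s ∧ m < S.card ∧
    ∀ d ∈ S, d.primeFactors = a.primeFactors ∧ N < d ∧ (d * s + 1).Prime := by
  set Q : Finset ℕ := {3, 5, 7, 11, 13, 17, 19, 23, 29, 31, 37, 41} with hQ
  have hQp : ∀ p ∈ Q, p.Prime := by
    intro p hp
    simp only [hQ, Finset.mem_insert, Finset.mem_singleton] at hp
    rcases hp with rfl | rfl | rfl | rfl | rfl | rfl | rfl | rfl | rfl | rfl | rfl | rfl <;>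
      norm_num
  set P : ℕ := ∏ p ∈ Q, p with hP
  have hPQ : P.primeFactors = Q := Nat.primeFactors_prod hQp
  have hP0 : P ≠ 0 := Finset.prod_ne_zero_iff.2 fun p hp => (hQp p hp).ne_zero
  have hPo : Odd P := by decide
  have hP2 : 2 ≤ P := by decide
  obtain ⟨T, s, hs, hcard⟩ := exists_card_filter_prime_gt hPo (by rw [hPQ]; decide)
    (Nat.succ_ne_zero N) m
  refine ⟨P, s, ((P ^ T).divisors.filter fun e => (P ^ (N + 1) * e * s + 1).Prime).image
    fun e => P ^ (N + 1) * e, hs, ?_, ?_⟩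
  · rwa [Finset.card_image_of_injective]
    exact fun a b h => Nat.eq_of_mul_eq_mul_left (by positivity) h
  · intro d hd
    obtain ⟨e, he, rfl⟩ := Finset.mem_image.1 hd
    obtain ⟨he, hp⟩ := Finset.mem_filter.1 he
    have he0 : 0 < e := Nat.pos_of_mem_divisors he
    refine ⟨?_, ?_, hp⟩
    · rw [Nat.primeFactors_mul (pow_ne_zero _ hP0) he0.ne', Nat.primeFactors_pow _ (by omega)]
      refine Finset.union_eq_left.2 ?_
      exact primeFactors_subset_of_dvd_pow hP0 (Nat.dvd_of_mem_divisors he)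
    · calc N < N + 1 := by omega
        _ < 2 ^ (N + 1) := Nat.lt_two_pow_self
        _ ≤ P ^ (N + 1) := Nat.pow_le_pow_left hP2 _
        _ ≤ P ^ (N + 1) * e := Nat.le_mul_of_pos_right _ he0

lemma IsCarmichael.sub_one_dvd_sub_one {n p : ℕ} (h : IsCarmichael n) (hp : p.Prime)
    (hpn : p ∣ n) : p - 1 ∣ n - 1 := by
  have := Fact.mk hp
  obtain ⟨g, hg⟩ := IsCyclic.exists_generator (α := (ZMod p)ˣ)
  have hord : orderOf g = p - 1 := by
    rw [orderOf_eq_card_of_forall_mem_zpowers hg, Nat.card_eq_fintype_card,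
      ZMod.card_units_eq_totient, Nat.totient_prime hp]
  rw [← hord]
  refine orderOf_dvd_of_pow_eq_one ?_
  have h1 : ((ZMod.val (g : ZMod p) : ℤ)) ^ n ≡ (ZMod.val (g : ZMod p) : ℤ) [ZMOD p] :=
    (h.2.2 _).of_dvd (by exact_mod_cast hpn)
  have h2 : (g : ZMod p) ^ n = g := by
    have := (ZMod.intCast_eq_intCast_iff _ _ p).2 h1
    simpa using this
  have h3 : g ^ n = g := Units.ext (by simpa using h2)
  have hn : n = (n - 1) + 1 := by have := h.1; omega
  rw [hn, pow_succ] at h3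
  exact mul_eq_right.1 h3

lemma rad_dvd {k n : ℕ} (hn : n ≠ 0) (h : ∀ l : ℕ, l.Prime → l ∣ k → l ∣ n) : rad k ∣ n := by
  refine (Finset.prod_dvd_prod_of_subset _ n.primeFactors _ fun l hl => ?_).trans
    (Nat.prod_primeFactors_dvd n)
  exact Nat.mem_primeFactors.2 ⟨Nat.prime_of_mem_primeFactors hl,
    h l (Nat.prime_of_mem_primeFactors hl) (Nat.dvd_of_mem_primeFactors hl), hn⟩

lemma totient_prod_primes {W : Finset ℕ} (hW : ∀ p ∈ W, p.Prime) :
    (∏ p ∈ W, p).totient = ∏ p ∈ W, (p - 1) := by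
  have h := Nat.totient_mul_prod_primeFactors (∏ p ∈ W, p)
  rw [Nat.primeFactors_prod hW, mul_comm] at h
  exact Nat.eq_of_mul_eq_mul_left (Finset.prod_pos fun p hp => (hW p hp).pos) h

lemma squarefree_prod_primes {W : Finset ℕ} (hW : ∀ p ∈ W, p.Prime) :
    Squarefree (∏ p ∈ W, p) := by
  refine Finset.squarefree_prod_of_pairwise_isCoprime (fun p hp q hq hpq => ?_)
    fun p hp => (hW p hp).squarefree
  exact Nat.coprime_iff_isRelPrime.1 ((Nat.coprime_primes (hW p hp) (hW q hq)).2 hpq)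

lemma rad_totient_prod_dvd {a s : ℕ} {W : Finset ℕ} (hW : ∀ p ∈ W, p.Prime)
    (h : ∀ p ∈ W, ∃ d : ℕ, d.primeFactors = a.primeFactors ∧ d ≠ 0 ∧ p = d * s + 1)
    (hne : W.Nonempty) : rad (∏ p ∈ W, p).totient ∣ ∏ p ∈ W, p - 1 := by
  have h1 : 1 < ∏ p ∈ W, p := by
    obtain ⟨p, hp⟩ := hne
    exact (hW p hp).one_lt.trans_le (Nat.le_of_dvd (Finset.prod_pos fun p hp => (hW p hp).pos)
      (Finset.dvd_prod_of_mem _ hp))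
  refine rad_dvd (by omega) fun l hl hlt => ?_
  rw [totient_prod_primes hW] at hlt
  obtain ⟨p, hp, hlp⟩ := (hl.prime.dvd_finsetProd_iff _).1 hlt
  obtain ⟨d, hd, hd0, rfl⟩ := h p hp
  have key : ∀ r ∈ W, r ≡ 1 [MOD l] := by
    intro r hr
    obtain ⟨e, he, he0, rfl⟩ := h r hr
    have : l ∣ e * s := by
      rw [Nat.add_sub_cancel, hl.dvd_mul] at hlp
      rcases hlp with hlp | hlp
      · have : l ∈ e.primeFactors := by
          rw [he, ← hd]
          exact Nat.mem_primeFactors.2 ⟨hl, hlp, hd0⟩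
        exact (Nat.dvd_of_mem_primeFactors this).mul_right _
      · exact hlp.mul_left _
    exact ((Nat.modEq_zero_iff_dvd.2 this).add_right 1)
  refine (Nat.modEq_iff_dvd' h1.le).1 (Nat.ModEq.symm ?_)
  have := Nat.ModEq.prod (s := W) (f := fun p => p) (g := fun _ => 1) (n := l) key
  simpa using this

lemma exists_not_isCarmichael_prod_erase {W : Finset ℕ} (hW : ∀ p ∈ W, p.Prime)
    (hcard : 3 ≤ W.card) : ∃ p ∈ W, ¬ IsCarmichael (∏ r ∈ W.erase p, r) := by
  have hne : W.Nonempty := Finset.card_pos.1 (by omega)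
  set M := W.max' hne with hM
  have hMW : M ∈ W := W.max'_mem hne
  have h2 : 1 < (W.erase M).card := by rw [Finset.card_erase_of_mem hMW]; omega
  obtain ⟨p, hp, q, hq, hpq⟩ := Finset.one_lt_card.1 h2
  obtain ⟨hpM, hpW⟩ := Finset.mem_erase.1 hp
  obtain ⟨hqM, hqW⟩ := Finset.mem_erase.1 hq
  by_contra! hcon
  have key : ∀ r ∈ W, r ≠ M → r ≡ ∏ p ∈ W, p [MOD (M - 1)] := by
    intro r hr hrM
    have hdvd := (hcon r hr).sub_one_dvd_sub_one (hW M hMW)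
      (Finset.dvd_prod_of_mem (fun r => r) (Finset.mem_erase.2 ⟨hrM.symm, hMW⟩))
    have h1 : 1 ≡ ∏ p ∈ W.erase r, p [MOD (M - 1)] :=
      (Nat.modEq_iff_dvd' (hcon r hr).1.le).2 hdvd
    rw [← Finset.mul_prod_erase W (fun p => p) hr]
    simpa using h1.mul_left r
  have hmod : p ≡ q [MOD (M - 1)] := (key p hpW hpM).trans (key q hqW hqM).symm
  have hpl : p < M := lt_of_le_of_ne (W.le_max' p hpW) hpM
  have hql : q < M := lt_of_le_of_ne (W.le_max' q hqW) hqM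
  have hp2 := (hW p hpW).two_le
  have hq2 := (hW q hqW).two_le
  have aux : ∀ p q : ℕ, 2 ≤ p → q < M → p < q → ¬ p ≡ q [MOD (M - 1)] := by
    intro p q hp2 hq hlt hmod
    have := Nat.le_of_dvd (by omega) ((Nat.modEq_iff_dvd' hlt.le).1 hmod)
    omega
  rcases lt_or_gt_of_ne hpq with h | h
  · exact aux p q hp2 hql h hmod
  · exact aux q p hq2 hpl h hmod.symm

/-- For every `m ≥ 2` there are infinitely many squarefree radimichael numbers with
exactly `m` distinct prime factors that are not Carmichael numbers. -/
theorem infinitely_many_radimichael_with_m_factors (m : ℕ) (hm : 2 ≤ m) :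
    {n : ℕ | Squarefree n ∧ n.primeFactors.card = m ∧
      rad (Nat.totient n) ∣ n - 1 ∧ ¬ IsCarmichael n}.Infinite := by
  refine Set.infinite_of_forall_exists_gt fun N => ?_
  obtain ⟨a, s, S, hs, hcard, hS⟩ := exists_prime_mul_add_one N m
  obtain ⟨S', hS', hcard'⟩ := Finset.exists_subset_card_eq (Nat.succ_le_of_lt hcard)
  set W := S'.image fun d => d * s + 1 with hWdef
  have hinj : Function.Injective fun d => d * s + 1 := fun a b h =>
    Nat.eq_of_mul_eq_mul_right hs (Nat.succ_injective h)
  have hWcard : W.card = m + 1 := by rw [hWdef, Finset.card_image_of_injective _ hinj, hcard']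
  have hW : ∀ p ∈ W, ∃ d : ℕ, d.primeFactors = a.primeFactors ∧ N < d ∧ p = d * s + 1 ∧
      p.Prime := by
    intro p hp
    obtain ⟨d, hd, rfl⟩ := Finset.mem_image.1 hp
    obtain ⟨h1, h2, h3⟩ := hS d (hS' hd)
    exact ⟨d, h1, h2, rfl, h3⟩
  have hWp : ∀ p ∈ W, p.Prime := fun p hp => (hW p hp).choose_spec.2.2.2
  obtain ⟨p, hp, hnC⟩ := exists_not_isCarmichael_prod_erase hWp (by omega)
  have hVp : ∀ r ∈ W.erase p, r.Prime := fun r hr => hWp r (Finset.mem_of_mem_erase hr)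
  have hVcard : (W.erase p).card = m := by rw [Finset.card_erase_of_mem hp]; omega
  have hne : (W.erase p).Nonempty := Finset.card_pos.1 (by omega)
  refine ⟨∏ r ∈ W.erase p, r, ⟨squarefree_prod_primes hVp, ?_, ?_, hnC⟩, ?_⟩
  · rw [Nat.primeFactors_prod hVp, hVcard]
  · refine rad_totient_prod_dvd (a := a) (s := s) hVp (fun r hr => ?_) hne
    obtain ⟨d, h1, h2, h3, -⟩ := hW r (Finset.mem_of_mem_erase hr)
    exact ⟨d, h1, by omega, h3⟩
  · obtain ⟨r, hr⟩ := hne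
    obtain ⟨d, h1, h2, h3, -⟩ := hW r (Finset.mem_of_mem_erase hr)
    calc N < d := h2
      _ ≤ d * s := Nat.le_mul_of_pos_right _ hs
      _ < r := by omega
      _ ≤ _ := Nat.le_of_dvd (Finset.prod_pos fun p hp => (hVp p hp).pos)
        (Finset.dvd_prod_of_mem (fun r => r) hr)
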